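/- arXiv:2002.07475 — 2 statements merged into one kernel-verified Lean document; each statement's English description precedes it below -/
import Mathlib

section
/- There is an absolute constant C such that the following holds uniformly for all real additive functions f for which the series Σ_p min(1, f(p)²)/p and Σ_{p : |f(p)|≤1} f(p)/p converge and Σ_{p : f(p)≠0} 1/p = ∞, all R ≥ 3, T ≥ 3, x ≥ 3, and all ε with 1/√(log x) < ε ≤ 1/2 satisfying 2·log₂R + (1/2)·T²·η_f(R) + 7 ≤ (1/4)·log(1/ε) and T²·η_f(x^ε) ≤ ε^{1/3}: sup_{y∈ℝ} |F_x(y) − F(y)| ≤ C·( Q_F(1/T) + ε^{1/6}·log(T·B_f(R)/ε) + η_f(R) ), where F is the limiting distribution function of f, whose characteristic function is φ_F(τ) = ∏_p (1 − 1/p)·Σ_{ν≥0} e^{iτ f(p^ν)}/p^ν. -/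
open Filter Topology Finset MeasureTheory
open scoped Classical

noncomputable section

/-- A real additive arithmetic function. -/
def IsAdditive (f : ℕ → ℝ) : Prop :=
  ∀ m n : ℕ, 0 < m → 0 < n → Nat.Coprime m n → f (m * n) = f m + f n

/-- A real strongly additive arithmetic function. -/
def IsStronglyAdditive (f : ℕ → ℝ) : Prop :=
  IsAdditive f ∧ ∀ p ν : ℕ, p.Prime → 1 ≤ ν → f (p ^ ν) = f p

/-- Convergence of the two Erdős–Wintner series. -/
def EWConv (f : ℕ → ℝ) : Prop :=
  Summable (fun p : Nat.Primes => min 1 (f p ^ 2) / (p : ℝ)) ∧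
  ∃ ℓ : ℝ, Tendsto (fun N : ℕ =>
      ∑ p ∈ (Finset.range N).filter (fun p => Nat.Prime p ∧ |f p| ≤ 1), f p / (p : ℝ))
    atTop (𝓝 ℓ)

/-- The series over primes with f(p) ≠ 0 of 1/p. -/
def DivergentCase (f : ℕ → ℝ) : Prop :=
  ¬ Summable (fun p : Nat.Primes => if f (p : ℕ) ≠ 0 then (1 : ℝ) / (p : ℕ) else 0)

def EtaBound (f : ℕ → ℝ) (η : ℝ → ℝ) : Prop :=
  Continuous η ∧ Antitone η ∧ Tendsto η atTop (𝓝 0) ∧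
  (∀ y : ℝ, 1 ≤ y → ∃ ℓ : ℝ,
    Tendsto (fun N : ℕ =>
        ∑ p ∈ (Finset.range N).filter (fun p => Nat.Prime p ∧ y < (p : ℝ) ∧ |f p| ≤ 1),
          f p / (p : ℝ)) atTop (𝓝 ℓ) ∧ |ℓ| ≤ η y) ∧
  (∀ y : ℝ, 1 ≤ y →
    (∑' n : ℕ, if IsPrimePow n ∧ y < (n : ℝ) then min 1 (f n ^ 2) / (n : ℝ) else 0) ≤ η y)

/-- The truncated additive function f_R. -/
def fR (f : ℕ → ℝ) (R : ℝ) (n : ℕ) : ℝ :=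
  ∑ p ∈ n.primeFactors,
    (if ((p ^ (n.factorization p) : ℕ) : ℝ) ≤ R ∨ |f (p ^ (n.factorization p))| ≤ 1
      then f (p ^ (n.factorization p)) else 0)

/-- B_f(v) := sqrt(2 + Σ_{p^ν ≤ v} f(p^ν)²/p^ν). -/
def Bf (f : ℕ → ℝ) (v : ℝ) : ℝ :=
  Real.sqrt (2 + ∑ n ∈ (Finset.Icc 2 ⌊v⌋₊).filter IsPrimePow, f n ^ 2 / (n : ℝ))

/-- π_k(x) = #{n ≤ x : ω(n) = k}. -/
def pik (x : ℝ) (k : ℕ) : ℕ :=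
  ((Finset.Icc 1 ⌊x⌋₊).filter (fun n => n.primeFactors.card = k)).card

/-- The empirical distribution function. -/
def Fx (f : ℕ → ℝ) (x : ℝ) (y : ℝ) : ℝ :=
  (((Finset.Icc 1 ⌊x⌋₊).filter (fun n => f n ≤ y)).card : ℝ) / x

def uf (f : ℕ → ℝ) (m : ℕ) : ℝ :=
  if ∀ p ∈ m.primeFactors, f (p ^ (m.factorization p)) ≠ 0 then 1 else 0

def vf (f : ℕ → ℝ) (d : ℕ) : ℝ :=
  if ∀ p ∈ d.primeFactors, f (p ^ (d.factorization p)) = 0 then 1 else 0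

def wp (f : ℕ → ℝ) (p : ℕ) : ℝ :=
  (1 - 1 / (p : ℝ)) * ∑' ν : ℕ, uf f (p ^ (ν + 1)) / (p : ℝ) ^ (ν + 1)

def hf (f : ℕ → ℝ) (m : ℕ) : ℝ :=
  uf f m * ∏ p ∈ m.primeFactors, (1 - 1 / (p : ℝ)) / (1 - wp f p)

def alphaf (f : ℕ → ℝ) (y : ℝ) : ℝ :=
  ∑' p : Nat.Primes, if y < ((p : ℕ) : ℝ) then uf f (p : ℕ) / ((p : ℕ) : ℝ) else 0

def betaf (f : ℕ → ℝ) (y : ℝ) : ℝ :=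
  (1 / Real.log y) * ∫ t in (1:ℝ)..y, alphaf f t / t

def Flim (f : ℕ → ℝ) (y : ℝ) : ℝ :=
  (∏' p : Nat.Primes, (1 - wp f (p : ℕ))) *
    ∑' m : ℕ, if 1 ≤ m ∧ f m ≤ y then hf f m / m else 0


lemma ew_count (N d : ℕ) : (((Finset.Ioc 0 N).filter (fun n => d ∣ n)).card : ℝ) ≤ (N:ℝ) / d ∧
    (N:ℝ) / d - 1 ≤ (((Finset.Ioc 0 N).filter (fun n => d ∣ n)).card : ℝ) := by
  have h : ((Finset.Ioc 0 N).filter (fun n => d ∣ n)).card = N / d := by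
    convert Nat.Ioc_filter_dvd_card_eq_div N d
  rw [h]
  refine ⟨Nat.cast_div_le, ?_⟩
  rcases Nat.eq_zero_or_pos d with rfl | hd
  · simp
  have h2 := Nat.div_add_mod N d
  have h3 := Nat.mod_lt N hd
  have hd' : (0:ℝ) < d := by exact_mod_cast hd
  rw [sub_le_iff_le_add, div_le_iff₀ hd']
  have : N ≤ (N / d + 1) * d := by nlinarith
  exact_mod_cast this

lemma ew_mertens (N : ℕ) (hN : 1 ≤ N) :
    ∑ p ∈ Nat.primesBelow (N+1), Real.log p / p ≤ Real.log N + Real.log 4 := by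
  have hN' : (0:ℝ) < N := by exact_mod_cast hN
  have h1 : ∑ n ∈ Finset.Ioc 0 N, ∑ p ∈ (Nat.primesBelow (N+1)).filter (fun p => p ∣ n), Real.log p
      ≤ N * Real.log N := by
    have : ∀ n ∈ Finset.Ioc 0 N, ∑ p ∈ (Nat.primesBelow (N+1)).filter (fun p => p ∣ n), Real.log p
      ≤ Real.log N := by
      intro n hn
      simp only [Finset.mem_Ioc] at hn
      have hs : (Nat.primesBelow (N+1)).filter (fun p => p ∣ n) = n.primeFactors := by
        ext p
        simp only [Finset.mem_filter, Nat.mem_primesBelow, Nat.mem_primeFactors]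
        constructor
        · rintro ⟨⟨_, h⟩, h'⟩; exact ⟨h, h', by omega⟩
        · rintro ⟨h, h', _⟩; exact ⟨⟨by have := Nat.le_of_dvd hn.1 h'; omega, h⟩, h'⟩
      rw [hs, ← Real.log_prod]
      · have h1 : (∏ p ∈ n.primeFactors, p) ≤ n := Nat.le_of_dvd hn.1 (Nat.prod_primeFactors_dvd n)
        have h2 : 0 < ∏ p ∈ n.primeFactors, p := Finset.prod_pos (fun p hp => Nat.pos_of_mem_primeFactors hp)
        have h3 : (∏ p ∈ n.primeFactors, (p:ℝ)) = ((∏ p ∈ n.primeFactors, p : ℕ) : ℝ) := by push_cast; rfl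
        rw [h3]
        apply Real.log_le_log (by exact_mod_cast h2)
        exact_mod_cast h1.trans hn.2
      · intro p hp
        have := Nat.pos_of_mem_primeFactors hp
        positivity
    calc _ ≤ ∑ n ∈ Finset.Ioc 0 N, Real.log N := Finset.sum_le_sum this
      _ = _ := by simp
  have h2 : ∑ n ∈ Finset.Ioc 0 N, ∑ p ∈ (Nat.primesBelow (N+1)).filter (fun p => p ∣ n), Real.log p
      = ∑ p ∈ Nat.primesBelow (N+1), Real.log p * (((Finset.Ioc 0 N).filter (fun n => p ∣ n)).card : ℝ) := by
    simp only [Finset.sum_filter]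
    rw [Finset.sum_comm]
    refine Finset.sum_congr rfl fun p _ => ?_
    rw [← Finset.sum_filter, Finset.sum_const, nsmul_eq_mul, mul_comm]
  have h3 : ∑ p ∈ Nat.primesBelow (N+1), Real.log p * ((N:ℝ) / p - 1) ≤ N * Real.log N := by
    rw [h2] at h1
    refine le_trans (Finset.sum_le_sum fun p hp => ?_) h1
    apply mul_le_mul_of_nonneg_left (ew_count N p).2
    exact Real.log_natCast_nonneg p
  have h4 : ∑ p ∈ Nat.primesBelow (N+1), Real.log p ≤ Real.log 4 * N := by
    have := Chebyshev.theta_le_log4_mul_x hN'.le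
    rw [Chebyshev.theta_eq_sum_Icc] at this
    simp only [Nat.floor_natCast] at this
    refine le_trans (le_of_eq ?_) this
    apply Finset.sum_congr _ (fun _ _ => rfl)
    ext p; simp [Nat.mem_primesBelow]
  have h5 : ∑ p ∈ Nat.primesBelow (N+1), Real.log p * ((N:ℝ) / p - 1) =
     N * ∑ p ∈ Nat.primesBelow (N+1), Real.log p / p - ∑ p ∈ Nat.primesBelow (N+1), Real.log p := by
    rw [Finset.mul_sum, ← Finset.sum_sub_distrib]
    refine Finset.sum_congr rfl fun p _ => by ring
  have h6 : N * ∑ p ∈ Nat.primesBelow (N+1), Real.log p / p ≤ N * (Real.log N + Real.log 4) := by linarith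
  exact le_of_mul_le_mul_left h6 hN'

/-- sum over multiples -/
lemma ew_dvd_all (N : ℕ) (U : Finset ℕ) (hU : ∀ p ∈ U, p.Prime) :
    |∑ m ∈ Finset.Ioc 0 N, ∏ p ∈ U, (if p ∣ m then (1:ℝ) else 0) - N * ∏ p ∈ U, (1:ℝ)/p| ≤ 1 := by
  have h : ∀ m, ∏ p ∈ U, (if p ∣ m then (1:ℝ) else 0) = if (∏ p ∈ U, p) ∣ m then 1 else 0 := by
    intro m
    rw [Finset.prod_ite_zero]
    simp only [Finset.prod_const_one]
    congr 1
    apply propext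
    constructor
    · intro h
      exact Finset.prod_primes_dvd m (fun p hp => (hU p hp).prime) h
    · intro h p hp
      exact (Finset.dvd_prod_of_mem _ hp).trans h
  simp only [h]
  rw [← Finset.sum_filter, Finset.sum_const, nsmul_eq_mul, mul_one]
  have := ew_count N (∏ p ∈ U, p)
  have h2 : (N:ℝ) * ∏ p ∈ U, (1:ℝ)/p = N / ((∏ p ∈ U, p : ℕ):ℝ) := by
    push_cast
    rw [Finset.prod_div_distrib]; simp [div_eq_mul_inv]
  rw [h2, abs_le]
  constructor <;> linarith

lemma ew_prod_one_add (N : ℕ) (W : Finset ℕ) (hW : ∀ p ∈ W, p.Prime) (a : ℕ → ℝ) :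
    |∑ m ∈ Finset.Ioc 0 N, ∏ p ∈ W, (1 + a p * (if p ∣ m then (1:ℝ) else 0)) - N * ∏ p ∈ W, (1 + a p / p)|
     ≤ ∏ p ∈ W, (1 + |a p|) := by
  simp only [Finset.prod_one_add, Finset.prod_mul_distrib]
  rw [Finset.sum_comm, Finset.mul_sum, ← Finset.sum_sub_distrib]
  refine (Finset.abs_sum_le_sum_abs _ _).trans (Finset.sum_le_sum fun U hU => ?_)
  have hU' : ∀ p ∈ U, p.Prime := fun p hp => hW p (Finset.mem_powerset.1 hU hp)
  rw [← Finset.mul_sum]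
  have : (∏ p ∈ U, a p) * ∑ m ∈ Finset.Ioc 0 N, ∏ p ∈ U, (if p ∣ m then (1:ℝ) else 0) - N * ∏ p ∈ U, a p / p
    = (∏ p ∈ U, a p) * (∑ m ∈ Finset.Ioc 0 N, ∏ p ∈ U, (if p ∣ m then (1:ℝ) else 0) - N * ∏ p ∈ U, (1:ℝ) / p) := by
    simp only [div_eq_mul_inv, Finset.prod_mul_distrib]; ring_nf; simp
  rw [this, abs_mul, Finset.abs_prod]
  calc _ ≤ (∏ p ∈ U, |a p|) * 1 := mul_le_mul_of_nonneg_left (ew_dvd_all N U hU') (Finset.prod_nonneg fun _ _ => abs_nonneg _)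
    _ = _ := mul_one _

def ewpsi (S : Finset ℕ) (m : ℕ) : ℝ := ∏ p ∈ S, (1 - (p:ℝ) * (if p ∣ m then (1:ℝ) else 0))

lemma ew_orth (N : ℕ) (S S' : Finset ℕ) (hS : ∀ p ∈ S, p.Prime) (hS' : ∀ p ∈ S', p.Prime) :
    |∑ m ∈ Finset.Ioc 0 N, ewpsi S m * ewpsi S' m - N * (if S = S' then ∏ p ∈ S, ((p:ℝ) - 1) else 0)|
      ≤ ((∏ p ∈ S, (p:ℝ)) * (∏ p ∈ S', (p:ℝ)))^2 := by
  set a : ℕ → ℝ := fun p => if p ∈ S ∩ S' then (p:ℝ) * (p - 2) else -p with ha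
  have hW : ∀ p ∈ S ∪ S', p.Prime := by
    intro p hp; rcases Finset.mem_union.1 hp with h | h
    exacts [hS p h, hS' p h]
  have key := ew_prod_one_add N (S ∪ S') hW a
  have e1 : ∀ m, ewpsi S m * ewpsi S' m = ∏ p ∈ S ∪ S', (1 + a p * (if p ∣ m then (1:ℝ) else 0)) := by
    intro m
    unfold ewpsi
    rw [Finset.prod_subset_one_on_sdiff (s₁ := S) (s₂ := S ∪ S') (g := fun p => if p ∈ S then (1 - (p:ℝ) * (if p ∣ m then (1:ℝ) else 0)) else 1) Finset.subset_union_left,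
      Finset.prod_subset_one_on_sdiff (s₁ := S') (s₂ := S ∪ S') (g := fun p => if p ∈ S' then (1 - (p:ℝ) * (if p ∣ m then (1:ℝ) else 0)) else 1) Finset.subset_union_right, ← Finset.prod_mul_distrib]
    · refine Finset.prod_congr rfl fun p hp => ?_
      simp only [ha, Finset.mem_inter]
      rcases Finset.mem_union.1 hp with h | h <;> by_cases h1 : p ∈ S <;> by_cases h2 : p ∈ S' <;> by_cases h3 : p ∣ m <;> simp_all <;> ring
    · intro p hp; simp at hp; simp [hp.2]
    · intro p hp; simp [hp]
    · intro p hp; simp at hp; simp [hp.2]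
    · intro p hp; simp [hp]
  have e2 : ∏ p ∈ S ∪ S', (1 + a p / p) = if S = S' then ∏ p ∈ S, ((p:ℝ) - 1) else 0 := by
    split_ifs with h
    · subst h
      rw [Finset.union_self]
      refine Finset.prod_congr rfl fun p hp => ?_
      have : (p:ℝ) ≠ 0 := by exact_mod_cast (hS p hp).ne_zero
      simp only [ha, Finset.inter_self, hp, if_true]
      field_simp; ring
    · have : ∃ p ∈ S ∪ S', p ∉ S ∩ S' := by
        by_contra hc
        push Not at hc
        apply h
        ext p
        constructor
        · intro hp; exact (Finset.mem_inter.1 (hc p (Finset.mem_union_left _ hp))).2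
        · intro hp; exact (Finset.mem_inter.1 (hc p (Finset.mem_union_right _ hp))).1
      obtain ⟨p, hp, hp2⟩ := this
      refine Finset.prod_eq_zero hp ?_
      have : (p:ℝ) ≠ 0 := by exact_mod_cast (hW p hp).ne_zero
      simp only [ha, hp2, if_false]
      field_simp; ring
  have e3 : ∏ p ∈ S ∪ S', (1 + |a p|) ≤ ((∏ p ∈ S, (p:ℝ)) * (∏ p ∈ S', (p:ℝ)))^2 := by
    calc ∏ p ∈ S ∪ S', (1 + |a p|) ≤ ∏ p ∈ S ∪ S', (p:ℝ)^2 := by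
          refine Finset.prod_le_prod (fun p _ => by positivity) fun p hp => ?_
          have : (2:ℝ) ≤ p := by exact_mod_cast (hW p hp).two_le
          simp only [ha]
          split_ifs
          · rw [abs_of_nonneg (by nlinarith)]; nlinarith
          · rw [abs_neg, abs_of_nonneg (by linarith)]; nlinarith
      _ ≤ (∏ p ∈ S ∪ S', (p:ℝ)^2) * (∏ p ∈ S ∩ S', (p:ℝ)^2) := by
          refine le_mul_of_one_le_right (Finset.prod_nonneg fun _ _ => by positivity) ?_
          rw [← Finset.prod_const_one (s := S ∩ S')]
          refine Finset.prod_le_prod (fun _ _ => zero_le_one) fun p hp => ?_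
          have : (2:ℝ) ≤ p := by exact_mod_cast (hS p (Finset.mem_inter.1 hp).1).two_le
          nlinarith
      _ = _ := by rw [Finset.prod_union_inter, Finset.prod_pow, Finset.prod_pow, mul_pow]
  rw [e2] at key
  simp only [e1]
  exact key.trans e3


def ewS (K Q : ℕ) : Finset (Finset ℕ) := (Nat.primesBelow K).powerset.filter (fun S => ∏ p ∈ S, p ≤ Q)
def ewg (S : Finset ℕ) : ℝ := ∏ p ∈ S, (1 / ((p:ℝ) - 1))
def ewG (K Q : ℕ) : ℝ := ∑ S ∈ ewS K Q, ewg S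
def ewV (K : ℕ) : ℝ := ∏ p ∈ Nat.primesBelow K, (1 - 1 / (p:ℝ))

lemma ewS_prime {K Q : ℕ} {S : Finset ℕ} (hS : S ∈ ewS K Q) : ∀ p ∈ S, p.Prime := by
  intro p hp
  simp only [ewS, Finset.mem_filter, Finset.mem_powerset] at hS
  exact Nat.prime_of_mem_primesBelow (hS.1 hp)

lemma ewg_pos {S : Finset ℕ} (hS : ∀ p ∈ S, p.Prime) : 0 < ewg S := by
  refine Finset.prod_pos fun p hp => ?_
  have : (2:ℝ) ≤ p := by exact_mod_cast (hS p hp).two_le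
  apply div_pos one_pos; linarith

lemma ewG_pos (K Q : ℕ) (hQ : 1 ≤ Q) : 0 < ewG K Q := by
  refine Finset.sum_pos (fun S hS => ewg_pos (ewS_prime hS)) ⟨∅, ?_⟩
  simp [ewS, hQ]

lemma ew_sieve (K Q N : ℕ) (hQ : 1 ≤ Q) :
    (((Finset.Ioc 0 N).filter (fun m => ∀ p, p.Prime → p < K → ¬ p ∣ m)).card : ℝ) ≤ N / ewG K Q + (Q:ℝ)^4 := by
  have hG := ewG_pos K Q hQ
  set w : ℕ → ℝ := fun m => ∑ S ∈ ewS K Q, ewg S * ewpsi S m with hw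
  have h1 : ∀ m ∈ (Finset.Ioc 0 N).filter (fun m => ∀ p, p.Prime → p < K → ¬ p ∣ m), w m ^ 2 = ewG K Q ^ 2 := by
    intro m hm
    have hm := (Finset.mem_filter.1 hm).2
    congr 1
    simp only [hw, ewG]
    refine Finset.sum_congr rfl fun S hS => ?_
    have : ewpsi S m = 1 := by
      refine Finset.prod_eq_one fun p hp => ?_
      have hpK : p < K := by
        simp only [ewS, Finset.mem_filter, Finset.mem_powerset] at hS
        exact Nat.lt_of_mem_primesBelow (hS.1 hp)
      simp [hm p (ewS_prime hS p hp) hpK]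
    rw [this, mul_one]
  have h2 : (((Finset.Ioc 0 N).filter (fun m => ∀ p, p.Prime → p < K → ¬ p ∣ m)).card : ℝ) * ewG K Q ^ 2
      ≤ ∑ m ∈ Finset.Ioc 0 N, w m ^ 2 := by
    rw [← nsmul_eq_mul, ← Finset.sum_const, ← Finset.sum_congr rfl h1]
    exact Finset.sum_le_sum_of_subset_of_nonneg (Finset.filter_subset _ _) fun _ _ _ => sq_nonneg _
  have h3 : ∑ m ∈ Finset.Ioc 0 N, w m ^ 2 = ∑ S ∈ ewS K Q, ∑ S' ∈ ewS K Q, ewg S * ewg S' *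
      ∑ m ∈ Finset.Ioc 0 N, ewpsi S m * ewpsi S' m := by
    have : ∀ m, w m ^ 2 = ∑ S ∈ ewS K Q, ∑ S' ∈ ewS K Q, (ewg S * ewpsi S m) * (ewg S' * ewpsi S' m) := by
      intro m; rw [sq, hw, Finset.sum_mul_sum]
    simp only [this, Finset.mul_sum]
    rw [Finset.sum_comm]
    refine Finset.sum_congr rfl fun S _ => ?_
    rw [Finset.sum_comm]
    refine Finset.sum_congr rfl fun S' _ => Finset.sum_congr rfl fun m _ => by ring
  have h4 : ∑ m ∈ Finset.Ioc 0 N, w m ^ 2 ≤ ∑ S ∈ ewS K Q, ∑ S' ∈ ewS K Q, ewg S * ewg S' *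
      (N * (if S = S' then ∏ p ∈ S, ((p:ℝ) - 1) else 0) + (Q:ℝ)^4) := by
    rw [h3]
    refine Finset.sum_le_sum fun S hS => Finset.sum_le_sum fun S' hS' => ?_
    apply mul_le_mul_of_nonneg_left _ (mul_pos (ewg_pos (ewS_prime hS)) (ewg_pos (ewS_prime hS'))).le
    have := (abs_le.1 (ew_orth N S S' (ewS_prime hS) (ewS_prime hS'))).2
    have hb : ∀ S ∈ ewS K Q, (∏ p ∈ S, (p:ℝ)) ≤ Q := by
      intro S hS
      simp only [ewS, Finset.mem_filter, Finset.mem_powerset] at hS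
      rw [← Nat.cast_prod]; exact Nat.cast_le.2 hS.2
    have hb0 : ∀ S : Finset ℕ, 0 ≤ (∏ p ∈ S, (p:ℝ)) := fun S => Finset.prod_nonneg fun _ _ => by positivity
    have h5 : ((∏ p ∈ S, (p:ℝ)) * (∏ p ∈ S', (p:ℝ)))^2 ≤ (Q:ℝ)^4 := by
      calc ((∏ p ∈ S, (p:ℝ)) * (∏ p ∈ S', (p:ℝ)))^2 ≤ ((Q:ℝ) * Q)^2 := by
            apply pow_le_pow_left₀ (mul_nonneg (hb0 _) (hb0 _))
            exact mul_le_mul (hb S hS) (hb S' hS') (hb0 _) (by positivity)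
        _ = _ := by ring
    linarith
  have h5 : ∑ S ∈ ewS K Q, ∑ S' ∈ ewS K Q, ewg S * ewg S' *
      (N * (if S = S' then ∏ p ∈ S, ((p:ℝ) - 1) else 0) + (Q:ℝ)^4) = N * ewG K Q + ewG K Q ^2 * (Q:ℝ)^4 := by
    simp only [mul_add, Finset.sum_add_distrib]
    congr 1
    · rw [ewG, Finset.mul_sum]
      refine Finset.sum_congr rfl fun S hS => ?_
      rw [Finset.sum_eq_single S]
      · have : ewg S * ∏ p ∈ S, ((p:ℝ) - 1) = 1 := by
          rw [ewg, ← Finset.prod_mul_distrib]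
          refine Finset.prod_eq_one fun p hp => ?_
          have : (2:ℝ) ≤ p := by exact_mod_cast (ewS_prime hS p hp).two_le
          rw [one_div, inv_mul_cancel₀]; linarith
        simp only [if_true]
        linear_combination (N * ewg S) * this
      · intro S' _ hne; simp [hne.symm]
      · intro h; exact absurd hS h
    · rw [sq, ewG, Finset.sum_mul_sum, Finset.sum_mul]
      refine Finset.sum_congr rfl fun S hS => ?_
      rw [Finset.sum_mul]
  have h6 : (((Finset.Ioc 0 N).filter (fun m => ∀ p, p.Prime → p < K → ¬ p ∣ m)).card : ℝ) * ewG K Q ^ 2 ≤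
     (N / ewG K Q + (Q:ℝ)^4) * ewG K Q ^ 2 := by
    have : (N / ewG K Q + (Q:ℝ)^4) * ewG K Q ^ 2 = N * ewG K Q + ewG K Q ^2 * (Q:ℝ)^4 := by
      field_simp
    linarith
  exact le_of_mul_le_mul_right h6 (by positivity)

lemma ewV_pos (K : ℕ) : 0 < ewV K := by
  refine Finset.prod_pos fun p hp => ?_
  have : (2:ℝ) ≤ p := by exact_mod_cast (Nat.prime_of_mem_primesBelow hp).two_le
  rw [sub_pos, div_lt_one (by linarith)]; linarith

lemma ew_Ginv (K : ℕ) : (ewV K)⁻¹ = ∑ S ∈ (Nat.primesBelow K).powerset, ewg S := by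
  unfold ewg
  rw [← Finset.prod_one_add, ewV, ← Finset.prod_inv_distrib]
  refine Finset.prod_congr rfl fun p hp => ?_
  have : (2:ℝ) ≤ p := by exact_mod_cast (Nat.prime_of_mem_primesBelow hp).two_le
  have h1 : (p:ℝ) - 1 ≠ 0 := by linarith
  have h2 : (p:ℝ) ≠ 0 := by linarith
  field_simp
  ring

lemma ew_insert_sum (K p : ℕ) (hp : p ∈ Nat.primesBelow K) :
    ∑ S ∈ (Nat.primesBelow K).powerset.filter (fun S => p ∈ S), ewg S = (ewV K)⁻¹ * (1 / p) := by
  have hpp : (2:ℝ) ≤ p := by exact_mod_cast (Nat.prime_of_mem_primesBelow hp).two_le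
  have hne : (p:ℝ) - 1 ≠ 0 := by linarith
  have hne2 : (p:ℝ) ≠ 0 := by linarith
  set P := (Nat.primesBelow K).erase p with hP
  have hP' : Nat.primesBelow K = insert p P := (Finset.insert_erase hp).symm
  have hpP : p ∉ P := Finset.notMem_erase _ _
  have e1 : ∑ S ∈ (Nat.primesBelow K).powerset.filter (fun S => p ∈ S), ewg S = (1 / ((p:ℝ)-1)) * ∑ S ∈ P.powerset, ewg S := by
    rw [hP', Finset.powerset_insert, Finset.filter_union, Finset.mul_sum]
    have : P.powerset.filter (fun S => p ∈ S) = ∅ := by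
      apply Finset.filter_false_of_mem
      intro S hS h
      exact hpP (Finset.mem_powerset.1 hS h)
    rw [this, Finset.empty_union, Finset.filter_true_of_mem, Finset.sum_image]
    · refine Finset.sum_congr rfl fun S hS => ?_
      have : p ∉ S := fun h => hpP (Finset.mem_powerset.1 hS h)
      rw [ewg, Finset.prod_insert this, ewg]
    · intro S hS S' hS' h
      have h1 : p ∉ S := fun h => hpP (Finset.mem_powerset.1 hS h)
      have h2 : p ∉ S' := fun h => hpP (Finset.mem_powerset.1 hS' h)
      rw [← Finset.erase_insert h1, ← Finset.erase_insert h2, h]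
    · intro S hS
      obtain ⟨S', _, rfl⟩ := Finset.mem_image.1 hS
      exact Finset.mem_insert_self _ _
  have e2 : (ewV K)⁻¹ = (1 + 1 / ((p:ℝ)-1)) * ∑ S ∈ P.powerset, ewg S := by
    rw [ew_Ginv]
    unfold ewg
    rw [← Finset.prod_one_add, ← Finset.prod_one_add, hP', Finset.prod_insert hpP]
  rw [e1, e2]
  field_simp
  ring

lemma ewG_lower (K Q : ℕ) (hQ : 2 ≤ Q) :
    (ewV K)⁻¹ * (1 - (∑ p ∈ Nat.primesBelow K, Real.log p / p) / Real.log Q) ≤ ewG K Q := by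
  have hlQ : 0 < Real.log Q := Real.log_pos (by exact_mod_cast hQ)
  have h0 : (ewV K)⁻¹ = ewG K Q + ∑ S ∈ (Nat.primesBelow K).powerset.filter (fun S => ¬ ∏ p ∈ S, p ≤ Q), ewg S := by
    rw [ew_Ginv, ewG, ewS, Finset.sum_filter_add_sum_filter_not]
  have h1 : Real.log Q * ∑ S ∈ (Nat.primesBelow K).powerset.filter (fun S => ¬ ∏ p ∈ S, p ≤ Q), ewg S ≤
      (ewV K)⁻¹ * (∑ p ∈ Nat.primesBelow K, Real.log p / p) := by
    have hpr : ∀ S ∈ (Nat.primesBelow K).powerset, ∀ p ∈ S, p.Prime := fun S hS p hp =>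
      Nat.prime_of_mem_primesBelow (Finset.mem_powerset.1 hS hp)
    have hlog : ∀ S ∈ (Nat.primesBelow K).powerset, 0 ≤ ∑ p ∈ S, Real.log p := fun S hS =>
      Finset.sum_nonneg fun p hp => Real.log_natCast_nonneg p
    calc Real.log Q * ∑ S ∈ (Nat.primesBelow K).powerset.filter (fun S => ¬ ∏ p ∈ S, p ≤ Q), ewg S
        ≤ ∑ S ∈ (Nat.primesBelow K).powerset.filter (fun S => ¬ ∏ p ∈ S, p ≤ Q), (∑ p ∈ S, Real.log p) * ewg S := by
          rw [Finset.mul_sum]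
          refine Finset.sum_le_sum fun S hS => ?_
          have hS' := Finset.mem_filter.1 hS
          apply mul_le_mul_of_nonneg_right _ (ewg_pos (hpr S hS'.1)).le
          rw [← Real.log_prod (fun p hp => by exact_mod_cast (hpr S hS'.1 p hp).ne_zero)]
          apply Real.log_le_log (by positivity)
          have := (not_le.1 hS'.2).le
          rw [← Nat.cast_prod]; exact Nat.cast_le.2 this
      _ ≤ ∑ S ∈ (Nat.primesBelow K).powerset, (∑ p ∈ S, Real.log p) * ewg S := by
          apply Finset.sum_le_sum_of_subset_of_nonneg (Finset.filter_subset _ _)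
          intro S hS _
          exact mul_nonneg (hlog S hS) (ewg_pos (hpr S hS)).le
      _ = ∑ S ∈ (Nat.primesBelow K).powerset, ∑ p ∈ Nat.primesBelow K, (if p ∈ S then Real.log p * ewg S else 0) := by
          refine Finset.sum_congr rfl fun S hS => ?_
          rw [← Finset.sum_filter, Finset.sum_mul]
          apply Finset.sum_congr _ (fun _ _ => rfl)
          ext p; simp only [Finset.mem_filter]
          exact ⟨fun h => ⟨Finset.mem_powerset.1 hS h, h⟩, fun h => h.2⟩
      _ = ∑ p ∈ Nat.primesBelow K, Real.log p * ((ewV K)⁻¹ * (1 / p)) := by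
          rw [Finset.sum_comm]
          refine Finset.sum_congr rfl fun p hp => ?_
          rw [← Finset.sum_filter, ← Finset.mul_sum, ew_insert_sum K p hp]
      _ = _ := by
          rw [Finset.mul_sum]
          exact Finset.sum_congr rfl fun p hp => by ring
  have h2 : ∑ S ∈ (Nat.primesBelow K).powerset.filter (fun S => ¬ ∏ p ∈ S, p ≤ Q), ewg S ≤
      (ewV K)⁻¹ * (∑ p ∈ Nat.primesBelow K, Real.log p / p) / Real.log Q := by
    rw [le_div_iff₀ hlQ]; linarith
  have h3 : (ewV K)⁻¹ * (1 - (∑ p ∈ Nat.primesBelow K, Real.log p / p) / Real.log Q) = 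
     (ewV K)⁻¹ - (ewV K)⁻¹ * (∑ p ∈ Nat.primesBelow K, Real.log p / p) / Real.log Q := by ring
  linarith

/-- upper bound sieve with sharp constant -/
lemma ew_sieve2 (K Q N : ℕ) (hQ : 2 ≤ Q) (κ : ℝ) (hκ : κ ≤ 1/2)
    (h : (∑ p ∈ Nat.primesBelow K, Real.log p / p) ≤ κ * Real.log Q) :
    (((Finset.Ioc 0 N).filter (fun m => ∀ p, p.Prime → p < K → ¬ p ∣ m)).card : ℝ) ≤
      N * ewV K * (1 + 2 * κ) + (Q:ℝ)^4 := by
  have hlQ : 0 < Real.log Q := Real.log_pos (by exact_mod_cast hQ)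
  have hκ0 : 0 ≤ κ := by
    have : 0 ≤ (∑ p ∈ Nat.primesBelow K, Real.log p / p) := 
      Finset.sum_nonneg fun p hp => div_nonneg (Real.log_natCast_nonneg p) (by positivity)
    by_contra hc
    nlinarith
  have hV := ewV_pos K
  have h1 := ew_sieve K Q N (by omega)
  have hG := ewG_pos K Q (by omega)
  have h2 := ewG_lower K Q hQ
  have h3 : (ewV K)⁻¹ * (1 - κ) ≤ ewG K Q := by
    refine le_trans (mul_le_mul_of_nonneg_left ?_ (inv_pos.2 hV).le) h2
    have : (∑ p ∈ Nat.primesBelow K, Real.log p / p) / Real.log Q ≤ κ := by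
      rwa [div_le_iff₀ hlQ]
    linarith
  have h4 : 1 ≤ ewG K Q * (ewV K * (1 + 2 * κ)) := by
    have : (ewV K)⁻¹ * (1 - κ) * (ewV K * (1 + 2 * κ)) ≤ ewG K Q * (ewV K * (1 + 2 * κ)) := 
      mul_le_mul_of_nonneg_right h3 (by positivity)
    have h5 : (ewV K)⁻¹ * (1 - κ) * (ewV K * (1 + 2 * κ)) = (1-κ) * (1+2*κ) := by field_simp
    nlinarith
  have h6 : (N:ℝ) / ewG K Q ≤ N * ewV K * (1 + 2 * κ) := by
    rw [div_le_iff₀ hG]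
    nlinarith [Nat.cast_nonneg (α := ℝ) N]
  linarith


def ewM (w : ℕ → ℝ) : Measure ℕ := Measure.sum (fun n => ENNReal.ofReal (w n) • Measure.dirac n)

lemma ewM_apply (w : ℕ → ℝ) (h0 : ∀ n, 0 ≤ w n) (hs : Summable w) (A : Set ℕ) :
    ewM w A = ENNReal.ofReal (∑' n, A.indicator w n) := by
  have hA : MeasurableSet A := trivial
  rw [ewM, Measure.sum_apply _ hA, ENNReal.ofReal_tsum_of_nonneg _ (hs.indicator A)]
  · refine tsum_congr fun n => ?_
    by_cases h : n ∈ A <;> simp [h]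
  · intro n; exact Set.indicator_nonneg (fun _ _ => h0 _) _

lemma ewM_real (w : ℕ → ℝ) (h0 : ∀ n, 0 ≤ w n) (hs : Summable w) (A : Set ℕ) :
    (ewM w).real A = ∑' n, A.indicator w n := by
  rw [Measure.real, ewM_apply w h0 hs, ENNReal.toReal_ofReal]
  exact tsum_nonneg fun n => Set.indicator_nonneg (fun _ _ => h0 _) _

lemma ewM_prob (w : ℕ → ℝ) (h0 : ∀ n, 0 ≤ w n) (hs : HasSum w 1) : IsProbabilityMeasure (ewM w) := by
  constructor
  rw [ewM_apply w h0 hs.summable]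
  simp [hs.tsum_eq]

/-- weights of the model -/
def ewq (K : ℕ) : ℕ → ℝ := (Nat.smoothNumbers K).indicator (fun n => ewV K / n)
def ewQ (K : ℕ) : Measure ℕ := ewM (ewq K)

def ewu (N : ℕ) : ℕ → ℝ := fun n => if n ∈ Finset.Ioc 0 N then 1 / (N:ℝ) else 0
def ewU (N : ℕ) : Measure ℕ := ewM (ewu N)

lemma ewq_nonneg (K n : ℕ) : 0 ≤ ewq K n :=
  Set.indicator_nonneg (fun _ _ => div_nonneg (ewV_pos K).le (by positivity)) _

def ewinv : ℕ →* ℝ where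
  toFun n := (n:ℝ)⁻¹
  map_one' := by simp
  map_mul' m n := by push_cast; rw [mul_inv]

lemma ewinv_lt {p : ℕ} (hp : p.Prime) : ‖ewinv p‖ < 1 := by
  have : (2:ℝ) ≤ p := by exact_mod_cast hp.two_le
  simp only [ewinv, MonoidHom.coe_mk, OneHom.coe_mk, norm_inv, RCLike.norm_natCast]
  exact inv_lt_one_of_one_lt₀ (by linarith)

lemma ewq_hasSum (K : ℕ) : HasSum (ewq K) 1 := by
  have h := (EulerProduct.summable_and_hasSum_smoothNumbers_prod_primesBelow_geometric (f := ewinv)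
    (fun hp => ewinv_lt hp) K).2
  have h2 := h.mul_left (ewV K)
  rw [ewq, ← hasSum_subtype_iff_indicator]
  have e : ewV K * ∏ p ∈ Nat.primesBelow K, (1 - ewinv p)⁻¹ = 1 := by
    rw [ewV, ← Finset.prod_mul_distrib]
    refine Finset.prod_eq_one fun p hp => ?_
    have : (2:ℝ) ≤ p := by exact_mod_cast (Nat.prime_of_mem_primesBelow hp).two_le
    simp only [ewinv, MonoidHom.coe_mk, OneHom.coe_mk, one_div]
    apply mul_inv_cancel₀
    have : (p:ℝ)⁻¹ < 1 := inv_lt_one_of_one_lt₀ (by linarith)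
    linarith
  rw [e] at h2
  exact h2

instance ewQ_prob (K : ℕ) : IsProbabilityMeasure (ewQ K) := ewM_prob _ (ewq_nonneg K) (ewq_hasSum K)

lemma ewQ_real (K : ℕ) (A : Set ℕ) : (ewQ K).real A = ∑' n, A.indicator (ewq K) n :=
  ewM_real _ (ewq_nonneg K) (ewq_hasSum K).summable A

lemma ewu_nonneg (N n : ℕ) : 0 ≤ ewu N n := by unfold ewu; positivity

lemma ewu_summable (N : ℕ) : Summable (ewu N) := by
  apply summable_of_ne_finset_zero (s := Finset.Ioc 0 N)
  intro n hn; simp [ewu, hn]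

lemma ewU_real (N : ℕ) (A : Set ℕ) :
    (ewU N).real A = (((Finset.Ioc 0 N).filter (fun n => n ∈ A)).card : ℝ) / N := by
  rw [ewU, ewM_real _ (ewu_nonneg N) (ewu_summable N), tsum_eq_sum (s := Finset.Ioc 0 N)]
  · rw [Finset.card_filter]
    push_cast
    rw [Finset.sum_div]
    refine Finset.sum_congr rfl fun n hn => ?_
    by_cases h : n ∈ A
    · rw [Set.indicator_of_mem h, ewu, if_pos hn, if_pos h]
    · rw [Set.indicator_of_notMem h, if_neg h]; simp
  · intro n hn
    simp [Set.indicator_apply, ewu, hn]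

lemma ewU_prob (N : ℕ) (hN : 1 ≤ N) : IsProbabilityMeasure (ewU N) := by
  have h : (ewU N).real Set.univ = 1 := by
    have : (N:ℝ) ≠ 0 := by positivity
    rw [ewU_real]; simp [this]
  constructor
  rw [Measure.real] at h
  have := (ENNReal.toReal_eq_one_iff _).1 h
  exact this

lemma ewQ_dvd (K d : ℕ) (hd : d ∈ Nat.smoothNumbers K) : (ewQ K).real {n | d ∣ n} = 1 / d := by
  have hd0 : d ≠ 0 := Nat.ne_zero_of_mem_smoothNumbers hd
  rw [ewQ_real]
  have hinj : Function.Injective (fun m : ℕ => d * m) := fun a b h => Nat.eq_of_mul_eq_mul_left (Nat.pos_of_ne_zero hd0) h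
  rw [← hinj.tsum_eq]
  · have : ∀ m, Set.indicator {n | d ∣ n} (ewq K) (d * m) = (1 / d) * ewq K m := by
      intro m
      rw [Set.indicator_of_mem (by simp)]
      unfold ewq
      by_cases hm : m ∈ Nat.smoothNumbers K
      · rw [Set.indicator_of_mem (Nat.mul_mem_smoothNumbers hd hm), Set.indicator_of_mem hm]
        push_cast
        have : (d:ℝ) ≠ 0 := by exact_mod_cast hd0
        field_simp
      · rw [Set.indicator_of_notMem hm, Set.indicator_of_notMem, mul_zero]
        intro h; exact hm (Nat.mem_smoothNumbers_of_dvd h (Dvd.intro_left d rfl))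
    simp only [this]
    rw [tsum_mul_left, (ewq_hasSum K).tsum_eq, mul_one]
  · intro n hn
    have : n ∈ {n | d ∣ n} := by
      by_contra h
      exact hn (Set.indicator_of_notMem h _)
    obtain ⟨m, rfl⟩ := this
    exact ⟨m, rfl⟩

lemma ewQ_dvd_le (K d : ℕ) : (ewQ K).real {n | d ∣ n} ≤ 1 / d := by
  by_cases hd : d ∈ Nat.smoothNumbers K
  · exact (ewQ_dvd K d hd).le
  · rw [ewQ_real]
    have : ∀ n, Set.indicator {n | d ∣ n} (ewq K) n = 0 := by
      intro n
      by_cases h : d ∣ n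
      · rw [Set.indicator_of_mem (s := {n | d ∣ n}) (a := n) h, ewq, Set.indicator_of_notMem]
        intro h2; exact hd (Nat.mem_smoothNumbers_of_dvd h2 h)
      · rw [Set.indicator_of_notMem (s := {n | d ∣ n}) (a := n) h]
    simp only [this, tsum_zero]
    positivity

lemma ewU_dvd (N d : ℕ) (hN : 1 ≤ N) : (ewU N).real {n | d ∣ n} ≤ 1 / d ∧ |(ewU N).real {n | d ∣ n} - 1 / d| ≤ 1 / N := by
  rw [ewU_real]
  simp only [Set.mem_ofPred_eq]
  obtain ⟨h1, h2⟩ := ew_count N d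
  have hN' : (0:ℝ) < N := by exact_mod_cast hN
  have h3 : (((Finset.Ioc 0 N).filter (fun n => d ∣ n)).card : ℝ) / N ≤ 1 / d := by
    rw [div_le_iff₀ hN']; calc _ ≤ _ := h1
      _ = _ := by ring
  refine ⟨h3, ?_⟩
  rw [abs_le]
  constructor
  · have : ((N:ℝ)/d - 1) / N ≤ (((Finset.Ioc 0 N).filter (fun n => d ∣ n)).card : ℝ) / N := by gcongr
    have e : ((N:ℝ)/d - 1) / N = 1 / d - 1 / N := by
      field_simp
    linarith
  · have : 0 ≤ 1 / (N:ℝ) := by positivity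
    linarith

/-- smooth and rough parts -/
def ewsm (K n : ℕ) : ℕ := ∏ p ∈ n.primeFactors.filter (fun p => p < K), p ^ (n.factorization p)
def ewrg (K n : ℕ) : ℕ := ∏ p ∈ n.primeFactors.filter (fun p => ¬ p < K), p ^ (n.factorization p)

lemma ew_sm_mul_rg (K n : ℕ) (hn : n ≠ 0) : ewsm K n * ewrg K n = n := by
  rw [ewsm, ewrg, Finset.prod_filter_mul_prod_filter_not]
  exact Nat.prod_factorization_pow_eq_self hn

lemma ew_pow_coprime {p q a b : ℕ} (hp : p.Prime) (hq : q.Prime) (h : p ≠ q) : Nat.Coprime (p^a) (q^b) :=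
  Nat.Coprime.pow _ _ ((Nat.coprime_primes hp hq).2 h)

lemma ew_sm_coprime_rg (K n : ℕ) : Nat.Coprime (ewsm K n) (ewrg K n) := by
  unfold ewsm ewrg
  refine Nat.Coprime.prod_left fun p hp => Nat.Coprime.prod_right fun q hq => ?_
  simp only [Finset.mem_filter] at hp hq
  refine ew_pow_coprime (Nat.prime_of_mem_primeFactors hp.1) (Nat.prime_of_mem_primeFactors hq.1) ?_
  rintro rfl; exact hq.2 hp.2

lemma ew_sm_pos (K n : ℕ) : 0 < ewsm K n :=
  Finset.prod_pos fun _ hp => pow_pos (Nat.pos_of_mem_primeFactors (Finset.mem_filter.1 hp).1) _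
lemma ew_rg_pos (K n : ℕ) : 0 < ewrg K n :=
  Finset.prod_pos fun _ hp => pow_pos (Nat.pos_of_mem_primeFactors (Finset.mem_filter.1 hp).1) _

lemma ew_sm_smooth (K n : ℕ) : ewsm K n ∈ Nat.smoothNumbers K := by
  rw [Nat.mem_smoothNumbers']
  intro q hq hd
  obtain ⟨p, hp, hqp⟩ := (hq.prime.dvd_finsetProd_iff _).1 hd
  simp only [Finset.mem_filter] at hp
  have := (Nat.prime_dvd_prime_iff_eq hq (Nat.prime_of_mem_primeFactors hp.1)).1 (hq.dvd_of_dvd_pow hqp)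
  rw [this]; exact hp.2

lemma ew_rg_rough (K n q : ℕ) (hq : q.Prime) (hd : q ∣ ewrg K n) : K ≤ q ∧ q ∣ n := by
  obtain ⟨p, hp, hqp⟩ := (hq.prime.dvd_finsetProd_iff _).1 hd
  simp only [Finset.mem_filter] at hp
  have := (Nat.prime_dvd_prime_iff_eq hq (Nat.prime_of_mem_primeFactors hp.1)).1 (hq.dvd_of_dvd_pow hqp)
  subst this
  exact ⟨by omega, Nat.dvd_of_mem_primeFactors hp.1⟩

lemma ewQ_map_sm_single (K M b : ℕ) (hKM : K ≤ M) :
    (ewQ M).real (ewsm K ⁻¹' {b}) ≤ ewq K b := by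
  rw [ewQ_real]
  by_cases hb : b ∈ Nat.smoothNumbers K
  swap
  · have : ewsm K ⁻¹' {b} = ∅ := by
      ext n; simp only [Set.mem_preimage, Set.mem_singleton_iff, Set.mem_empty_iff_false, iff_false]
      rintro rfl; exact hb (ew_sm_smooth K n)
    rw [this]; simp [ewq_nonneg]
  have hb0 : b ≠ 0 := Nat.ne_zero_of_mem_smoothNumbers hb
  have hb0' : (b:ℝ) ≠ 0 := by exact_mod_cast hb0
  have h := (EulerProduct.summable_and_hasSum_factoredNumbers_prod_filter_prime_geometric (f := ewinv)
    (fun hp => ewinv_lt hp) (Finset.Ico K M)).2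
  have hV : (∏ p ∈ Finset.Ico K M with p.Prime, (1 - ewinv p)⁻¹) * ewV M = ewV K := by
    have e : Nat.primesBelow M = Nat.primesBelow K ∪ (Finset.Ico K M).filter Nat.Prime := by
      ext p; simp only [Nat.mem_primesBelow, Finset.mem_union, Finset.mem_filter, Finset.mem_Ico]
      constructor
      · rintro ⟨h1, h2⟩
        by_cases h : p < K
        · exact Or.inl ⟨h, h2⟩
        · exact Or.inr ⟨⟨by omega, h1⟩, h2⟩
      · rintro (⟨h1, h2⟩ | ⟨⟨h1, h2⟩, h3⟩)
        · exact ⟨by omega, h2⟩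
        · exact ⟨h2, h3⟩
    have hdis : Disjoint (Nat.primesBelow K) ((Finset.Ico K M).filter Nat.Prime) := by
      rw [Finset.disjoint_left]
      intro p hp hp2
      simp only [Nat.mem_primesBelow, Finset.mem_filter, Finset.mem_Ico] at hp hp2
      omega
    rw [ewV, ewV, e, Finset.prod_union hdis, mul_left_comm, ← Finset.prod_mul_distrib]
    refine mul_eq_left₀ (ewV_pos K).ne' |>.2 (Finset.prod_eq_one ?_)
    intro p hp
    have : (2:ℝ) ≤ p := by exact_mod_cast (Finset.mem_filter.1 hp).2.two_le
    simp only [ewinv, MonoidHom.coe_mk, OneHom.coe_mk, one_div]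
    apply inv_mul_cancel₀
    have : (p:ℝ)⁻¹ < 1 := inv_lt_one_of_one_lt₀ (by linarith)
    linarith
  have h2 := h.mul_right (ewV M / b)
  have hinj : Function.Injective (fun c : Nat.factoredNumbers (Finset.Ico K M) => b * (c:ℕ)) :=
    fun a c h => Subtype.ext (Nat.eq_of_mul_eq_mul_left (Nat.pos_of_ne_zero hb0) h)
  rw [← hinj.tsum_eq]
  · have e1 : ewq K b = (∏ p ∈ Finset.Ico K M with p.Prime, (1 - ewinv p)⁻¹) * (ewV M / b) := by
      rw [ewq, Set.indicator_of_mem hb, ← hV]; ring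
    rw [e1, ← h2.tsum_eq]
    have hle : ∀ c : Nat.factoredNumbers (Finset.Ico K M), (ewsm K ⁻¹' {b}).indicator (ewq M) (b * (c:ℕ)) ≤ ewinv c * (ewV M / b) := by
      intro c
      have hc : (c:ℕ) ≠ 0 := Nat.ne_zero_of_mem_factoredNumbers c.2
      have : ewq M (b * c) ≤ ewinv c * (ewV M / b) := by
        unfold ewq
        have e : ewV M / ((b * (c:ℕ) : ℕ):ℝ) = ewinv c * (ewV M / b) := by
          simp only [ewinv, MonoidHom.coe_mk, OneHom.coe_mk]; push_cast; field_simp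
        rw [← e]
        exact Set.indicator_apply_le' (fun _ => le_rfl) (fun _ => div_nonneg (ewV_pos M).le (by positivity))
      refine le_trans (Set.indicator_apply_le' (fun _ => this) (fun _ => ?_)) le_rfl
      exact (ewq_nonneg _ _).trans this
    refine Summable.tsum_le_tsum hle ?_ h2.summable
    refine Summable.of_nonneg_of_le (fun c => Set.indicator_nonneg (fun _ _ => ewq_nonneg _ _) _) hle h2.summable
  · intro n hn
    have h1 : ewsm K n = b := by
      by_contra hc
      exact hn (Set.indicator_of_notMem (by simpa using hc) _)
    have h3 : n ∈ Nat.smoothNumbers M := by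
      by_contra hc
      apply hn
      simp [Set.indicator_apply, ewq, hc]
    have hn0 : n ≠ 0 := Nat.ne_zero_of_mem_smoothNumbers h3
    refine ⟨⟨ewrg K n, ?_⟩, ?_⟩
    · rw [Nat.mem_factoredNumbers']
      intro p hp hd
      obtain ⟨h4, h5⟩ := ew_rg_rough K n p hp hd
      rw [Finset.mem_Ico]
      exact ⟨h4, Nat.mem_smoothNumbers'.1 h3 p hp h5⟩
    · simp only [← h1]
      exact ew_sm_mul_rg K n hn0

lemma ew_preimage_tsum (P : Measure ℕ) [IsProbabilityMeasure P] (g : ℕ → ℕ) (B : Set ℕ) :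
    HasSum (fun b => B.indicator (fun b => P.real (g ⁻¹' {b})) b) (P.real (g ⁻¹' B)) := by
  have hg : Measurable g := measurable_from_top
  have hB : MeasurableSet B := trivial
  have : IsProbabilityMeasure (P.map g) := Measure.isProbabilityMeasure_map hg.aemeasurable
  have e : ∀ A : Set ℕ, P.real (g ⁻¹' A) = (P.map g).real A := by
    intro A
    have hA : MeasurableSet A := trivial
    rw [Measure.real, Measure.real, Measure.map_apply hg hA]
  simp only [e]
  have h1 : (P.map g).real B = ∑' b, B.indicator (fun b => (P.map g).real {b}) b := by
    rw [Measure.real, ← Measure.tsum_indicator_apply_singleton _ B hB, ENNReal.tsum_toReal_eq]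
    · refine tsum_congr fun b => ?_
      by_cases h : b ∈ B <;> simp [h, Measure.real]
    · intro b
      by_cases h : b ∈ B <;> simp [h]
  rw [h1]
  apply Summable.hasSum
  apply Summable.indicator
  have h3 : ∑' b, (P.map g) {b} = 1 := by
    have := Measure.tsum_indicator_apply_singleton (P.map g) Set.univ MeasurableSet.univ
    simpa using this
  exact ENNReal.summable_toReal (by rw [h3]; simp)

lemma ewQ_map_sm (K M : ℕ) (hKM : K ≤ M) (B : Set ℕ) :
    (ewQ M).real (ewsm K ⁻¹' B) ≤ (ewQ K).real B := by
  have h := ew_preimage_tsum (ewQ M) (ewsm K) B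
  rw [ewQ_real K, ← h.tsum_eq]
  refine Summable.tsum_le_tsum (fun b => ?_) h.summable ((ewq_hasSum K).summable.indicator B)
  exact Set.indicator_le_indicator (ewQ_map_sm_single K M b hKM)


lemma ewU_sm_single (K N a : ℕ) (ha : 0 < a) :
    (ewU N).real (ewsm K ⁻¹' {a}) ≤
      (((Finset.Ioc 0 (N / a)).filter (fun m => ∀ p, p.Prime → p < K → ¬ p ∣ m)).card : ℝ) / N := by
  rw [ewU_real]
  refine div_le_div_of_nonneg_right ?_ (by positivity)
  refine Nat.cast_le.2 (Finset.card_le_card_of_injOn (ewrg K) ?_ ?_)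
  · intro n hn
    simp only [Finset.coe_filter, Set.mem_ofPred_eq, Finset.mem_Ioc, Set.mem_preimage, Set.mem_singleton_iff] at hn ⊢
    have h := ew_sm_mul_rg K n (by omega)
    rw [hn.2] at h
    refine ⟨⟨ew_rg_pos K n, ?_⟩, ?_⟩
    · rw [Nat.le_div_iff_mul_le ha, mul_comm]; omega
    · intro p hp hpK hd
      have := (ew_rg_rough K n p hp hd).1
      omega
  · intro n hn n' hn' h
    simp only [Finset.coe_filter, Set.mem_ofPred_eq, Finset.mem_Ioc, Set.mem_preimage, Set.mem_singleton_iff] at hn hn'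
    rw [← ew_sm_mul_rg K n (by omega), ← ew_sm_mul_rg K n' (by omega), hn.2, hn'.2, h]

lemma ewU_sm_single' (K Q N a : ℕ) (hN : 1 ≤ N) (ha : 0 < a) (hQ : 2 ≤ Q) (κ : ℝ) (hκ0 : 0 ≤ κ) (hκ : κ ≤ 1/2)
    (h : (∑ p ∈ Nat.primesBelow K, Real.log p / p) ≤ κ * Real.log Q) :
    (ewU N).real (ewsm K ⁻¹' {a}) ≤ ewq K a + 2 * κ * ewq K a + (Q:ℝ)^4 / N := by
  have hN' : (0:ℝ) < N := by exact_mod_cast hN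
  have ha' : (0:ℝ) < a := by exact_mod_cast ha
  have hq := ewq_nonneg K a
  by_cases hs : a ∈ Nat.smoothNumbers K
  swap
  · have : ewsm K ⁻¹' {a} = ∅ := by
      ext n; simp only [Set.mem_preimage, Set.mem_singleton_iff, Set.mem_empty_iff_false, iff_false]
      rintro rfl; exact hs (ew_sm_smooth K n)
    rw [this, measureReal_empty]
    positivity
  refine (ewU_sm_single K N a ha).trans ?_
  have h1 := ew_sieve2 K Q (N / a) hQ κ hκ h
  have h2 : ((N / a : ℕ):ℝ) ≤ (N:ℝ) / a := Nat.cast_div_le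
  have hV := ewV_pos K
  have h3 : ((N / a : ℕ):ℝ) * ewV K * (1 + 2 * κ) ≤ (N:ℝ) / a * ewV K * (1 + 2 * κ) := by
    gcongr
  rw [div_le_iff₀ hN', ewq, Set.indicator_of_mem hs]
  have e : (ewV K / a + 2 * κ * (ewV K / a) + (Q:ℝ)^4 / N) * N = (N:ℝ) / a * ewV K * (1 + 2 * κ) + (Q:ℝ)^4 := by
    field_simp
  rw [e]; linarith

lemma ewU_sm_bound (K Q N A : ℕ) (hN : 1 ≤ N) (hQ : 2 ≤ Q) (κ : ℝ) (hκ0 : 0 ≤ κ) (hκ : κ ≤ 1/2)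
    (h : (∑ p ∈ Nat.primesBelow K, Real.log p / p) ≤ κ * Real.log Q) (B : Set ℕ) :
    (ewU N).real (ewsm K ⁻¹' B) ≤ (ewQ K).real B + (2 * κ + A * ((Q:ℝ)^4 / N) + (ewU N).real {n | A < ewsm K n}) := by
  have := ewU_prob N hN
  set F := (Finset.Ioc 0 A).filter (fun a => a ∈ B) with hF
  have hsub : ewsm K ⁻¹' B ⊆ (⋃ a ∈ F, ewsm K ⁻¹' {a}) ∪ {n | A < ewsm K n} := by
    intro n hn
    by_cases h : A < ewsm K n
    · exact Or.inr h
    · left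
      simp only [Set.mem_iUnion, Set.mem_preimage, Set.mem_singleton_iff, exists_prop, exists_eq_right']
      simp only [hF, Finset.mem_filter, Finset.mem_Ioc]
      exact ⟨⟨ew_sm_pos K n, by omega⟩, hn⟩
  have h1 : (ewU N).real (ewsm K ⁻¹' B) ≤ ∑ a ∈ F, (ewU N).real (ewsm K ⁻¹' {a}) + (ewU N).real {n | A < ewsm K n} := by
    refine (measureReal_mono hsub).trans ((measureReal_union_le _ _).trans ?_)
    gcongr
    exact measureReal_biUnion_finset_le _ _
  have h2 : ∑ a ∈ F, (ewU N).real (ewsm K ⁻¹' {a}) ≤ ∑ a ∈ F, (ewq K a + 2 * κ * ewq K a + (Q:ℝ)^4 / N) := by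
    refine Finset.sum_le_sum fun a ha => ewU_sm_single' K Q N a hN ?_ hQ κ hκ0 hκ h
    simp only [hF, Finset.mem_filter, Finset.mem_Ioc] at ha; exact ha.1.1
  rw [Finset.sum_add_distrib, Finset.sum_add_distrib, ← Finset.mul_sum, Finset.sum_const, nsmul_eq_mul] at h2
  have h3 : ∑ a ∈ F, ewq K a ≤ (ewQ K).real B := by
    rw [ewQ_real]
    calc _ = ∑ a ∈ F, B.indicator (ewq K) a := by
          refine Finset.sum_congr rfl fun a ha => ?_
          rw [Set.indicator_of_mem (Finset.mem_filter.1 ha).2]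
      _ ≤ _ := Summable.sum_le_tsum _ (fun a _ => Set.indicator_nonneg (fun _ _ => ewq_nonneg _ _) _) ((ewq_hasSum K).summable.indicator B)
  have h4 : ∑ a ∈ F, ewq K a ≤ 1 := h3.trans measureReal_le_one
  have h5 : (F.card : ℝ) ≤ A := by
    have : F.card ≤ (Finset.Ioc 0 A).card := Finset.card_filter_le _ _
    rw [Nat.card_Ioc] at this
    exact_mod_cast this
  have h6 : (F.card : ℝ) * ((Q:ℝ)^4 / N) ≤ A * ((Q:ℝ)^4 / N) := by gcongr
  have h7 : 2 * κ * ∑ a ∈ F, ewq K a ≤ 2 * κ * 1 := by gcongr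
  linarith

lemma ew_fact (N : ℕ) : N.factorial = ∏ n ∈ Finset.Ioc 0 N, n := by
  induction N with
  | zero => simp
  | succ k ih => rw [Finset.prod_Ioc_succ_top (Nat.zero_le k), ← ih, Nat.factorial_succ, mul_comm]

lemma ew_sum_val (N p : ℕ) (hp : p.Prime) : ∑ n ∈ Finset.Ioc 0 N, (n.factorization p : ℝ) ≤ 2 * N / p := by
  have : Fact p.Prime := ⟨hp⟩
  have e : ∑ n ∈ Finset.Ioc 0 N, n.factorization p = padicValNat p (N.factorial) := by
    have h1 : N.factorial = ∏ n ∈ Finset.Ioc 0 N, n := by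
      exact ew_fact N
    rw [← Nat.factorization_def _ hp, h1, Nat.factorization_prod, Finset.sum_apply']
    intro n hn; simp at hn; omega
  have h := sub_one_mul_padicValNat_factorial (p := p) N
  have h2 : (p - 1) * padicValNat p N.factorial ≤ N := by rw [h]; exact Nat.sub_le _ _
  have hp2 := hp.two_le
  have hp' : (2:ℝ) ≤ p := by exact_mod_cast hp2
  rw [← Nat.cast_sum, e]
  have h3 : ((p:ℝ) - 1) * (padicValNat p N.factorial : ℝ) ≤ N := by
    have : ((p - 1 : ℕ):ℝ) = (p:ℝ) - 1 := by push_cast [Nat.cast_sub (show 1 ≤ p by omega)]; rfl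
    rw [← this]; exact_mod_cast h2
  rw [le_div_iff₀ (by linarith)]
  nlinarith [Nat.cast_nonneg (α := ℝ) (padicValNat p N.factorial)]

lemma ew_log_sm (K n : ℕ) : Real.log (ewsm K n) = ∑ p ∈ Nat.primesBelow K, (n.factorization p : ℝ) * Real.log p := by
  rw [ewsm]
  push_cast
  rw [Real.log_prod]
  · simp only [Real.log_pow]
    refine Finset.sum_subset ?_ ?_
    · intro p hp
      simp only [Finset.mem_filter] at hp
      exact Nat.mem_primesBelow.2 ⟨hp.2, Nat.prime_of_mem_primeFactors hp.1⟩
    · intro p hp hnp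
      rw [Nat.mem_primesBelow] at hp
      have : p ∉ n.primeFactors := fun h => hnp (Finset.mem_filter.2 ⟨h, hp.1⟩)
      rw [← Nat.support_factorization, Finsupp.notMem_support_iff] at this
      simp [this]
  · intro p hp
    have := Nat.pos_of_mem_primeFactors (Finset.mem_filter.1 hp).1
    positivity

lemma ewU_sm_large (K N A : ℕ) (hN : 1 ≤ N) (hA : 1 ≤ A) :
    (ewU N).real {n | A < ewsm K n} ≤ 2 * (∑ p ∈ Nat.primesBelow K, Real.log p / p) / Real.log (A+1) := by
  have hN' : (0:ℝ) < N := by exact_mod_cast hN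
  have hA' : (1:ℝ) ≤ A := by exact_mod_cast hA
  have hl : 0 < Real.log (A+1) := Real.log_pos (by linarith)
  rw [ewU_real, div_le_div_iff₀ hN' hl]
  simp only [Set.mem_ofPred_eq]
  calc _ = ∑ n ∈ (Finset.Ioc 0 N).filter (fun n => A < ewsm K n), Real.log (A+1) := by
        rw [Finset.sum_const, nsmul_eq_mul]
    _ ≤ ∑ n ∈ (Finset.Ioc 0 N).filter (fun n => A < ewsm K n), Real.log (ewsm K n) := by
        refine Finset.sum_le_sum fun n hn => ?_
        apply Real.log_le_log (by linarith)
        have := (Finset.mem_filter.1 hn).2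
        exact_mod_cast this
    _ ≤ ∑ n ∈ Finset.Ioc 0 N, Real.log (ewsm K n) :=
        Finset.sum_le_sum_of_subset_of_nonneg (Finset.filter_subset _ _) fun _ _ _ => Real.log_natCast_nonneg _
    _ = ∑ p ∈ Nat.primesBelow K, (∑ n ∈ Finset.Ioc 0 N, (n.factorization p : ℝ)) * Real.log p := by
        simp only [ew_log_sm, Finset.sum_mul]
        rw [Finset.sum_comm]
    _ ≤ ∑ p ∈ Nat.primesBelow K, (2 * N / p) * Real.log p := by
        refine Finset.sum_le_sum fun p hp => ?_
        exact mul_le_mul_of_nonneg_right (ew_sum_val N p (Nat.prime_of_mem_primesBelow hp)) (Real.log_natCast_nonneg _)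
    _ = _ := by
        rw [Finset.mul_sum, Finset.sum_mul]
        exact Finset.sum_congr rfl fun p _ => by ring


lemma ew_f_one (f : ℕ → ℝ) (hf : IsAdditive f) : f 1 = 0 := by
  have := hf 1 1 one_pos one_pos (Nat.coprime_one_left 1)
  simp at this; exact this

lemma ew_f_prod (f : ℕ → ℝ) (hf : IsAdditive f) (e : ℕ → ℕ) (S : Finset ℕ) (hS : ∀ p ∈ S, p.Prime) :
    f (∏ p ∈ S, p ^ e p) = ∑ p ∈ S, f (p ^ e p) := by
  induction S using Finset.induction_on with
  | empty => simp [ew_f_one f hf]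
  | insert q S hq ih =>
    have hS' : ∀ p ∈ S, p.Prime := fun p hp => hS p (Finset.mem_insert_of_mem hp)
    rw [Finset.prod_insert hq, Finset.sum_insert hq, hf, ih hS']
    · exact pow_pos (hS q (Finset.mem_insert_self _ _)).pos _
    · exact Finset.prod_pos fun p hp => pow_pos (hS' p hp).pos _
    · refine Nat.Coprime.prod_right fun p hp => ?_
      refine ew_pow_coprime (hS q (Finset.mem_insert_self _ _)) (hS' p hp) ?_
      rintro rfl; exact hq hp

lemma ew_f_split (f : ℕ → ℝ) (hf : IsAdditive f) (K n : ℕ) (hn : n ≠ 0) :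
    f n = f (ewsm K n) + f (ewrg K n) := by
  conv_lhs => rw [← ew_sm_mul_rg K n hn]
  exact hf _ _ (ew_sm_pos K n) (ew_rg_pos K n) (ew_sm_coprime_rg K n)

lemma ew_f_rg (f : ℕ → ℝ) (hf : IsAdditive f) (K n : ℕ) (hn : n ≠ 0)
    (h : ∀ p, p.Prime → K ≤ p → ¬ p ^ 2 ∣ n) :
    f (ewrg K n) = ∑ p ∈ n.primeFactors.filter (fun p => ¬ p < K), f p := by
  rw [ewrg, ew_f_prod f hf]
  · refine Finset.sum_congr rfl fun p hp => ?_
    simp only [Finset.mem_filter] at hp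
    have hpp := Nat.prime_of_mem_primeFactors hp.1
    have h1 : n.factorization p = 1 := by
      have h2 : ¬ 2 ≤ n.factorization p := fun hh => h p hpp (by omega) ((hpp.pow_dvd_iff_le_factorization hn).2 hh)
      have h3 : 1 ≤ n.factorization p := (hpp.pow_dvd_iff_le_factorization hn).1 (by simpa using Nat.dvd_of_mem_primeFactors hp.1)
      omega
    rw [h1, pow_one]
  · intro p hp; exact Nat.prime_of_mem_primeFactors (Finset.mem_filter.1 hp).1

lemma ew_cmp (f : ℕ → ℝ) (hf : IsAdditive f) (P : Measure ℕ) [IsProbabilityMeasure P] (K : ℕ) (t δ1 δ2 : ℝ)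
    (h0 : P.real {0} = 0)
    (h1 : ∀ B : Set ℕ, P.real (ewsm K ⁻¹' B) ≤ (ewQ K).real B + δ1)
    (h2 : P.real {n | t < |f (ewrg K n)|} ≤ δ2) (y : ℝ) :
    P.real {n | f n ≤ y} ≤ (ewQ K).real {n | f n ≤ y + t} + (δ1 + δ2) ∧
    (ewQ K).real {n | f n ≤ y} ≤ P.real {n | f n ≤ y + t} + (δ1 + δ2) := by
  have key : ∀ A B : Set ℕ, (∀ n, n ≠ 0 → n ∈ A → |f (ewrg K n)| ≤ t → ewsm K n ∈ B) →
      P.real A ≤ (ewQ K).real B + (δ1 + δ2) := by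
    intro A B hAB
    have hsub : A ⊆ (ewsm K ⁻¹' B) ∪ ({n | t < |f (ewrg K n)|} ∪ {0}) := by
      intro n hn
      by_cases hn0 : n = 0
      · right; right; exact hn0
      by_cases ht : t < |f (ewrg K n)|
      · right; left; exact ht
      · left; exact hAB n hn0 hn (not_lt.1 ht)
    calc P.real A ≤ P.real ((ewsm K ⁻¹' B) ∪ ({n | t < |f (ewrg K n)|} ∪ {0})) := measureReal_mono hsub
      _ ≤ P.real (ewsm K ⁻¹' B) + P.real ({n | t < |f (ewrg K n)|} ∪ {0}) := measureReal_union_le _ _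
      _ ≤ P.real (ewsm K ⁻¹' B) + (P.real ({n | t < |f (ewrg K n)|}) + P.real {0}) := by
          gcongr; exact measureReal_union_le _ _
      _ ≤ _ := by linarith [h1 B]
  constructor
  · apply key
    intro n hn hA ht
    have := ew_f_split f hf K n hn
    have h3 := abs_le.1 ht
    simp only [Set.mem_ofPred_eq] at hA ⊢
    linarith
  · have h4 := key {n | f n ≤ y + t}ᶜ {n | f n ≤ y}ᶜ (by
      intro n hn hA ht
      have := ew_f_split f hf K n hn
      have h3 := abs_le.1 ht
      simp only [Set.mem_compl_iff, Set.mem_ofPred_eq, not_le] at hA ⊢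
      linarith)
    rw [probReal_compl_eq_one_sub (MeasurableSet.of_discrete), probReal_compl_eq_one_sub (MeasurableSet.of_discrete)] at h4
    linarith

/-- the truncated sum -/
def ewh (S : Finset ℕ) (a : ℕ → ℝ) (n : ℕ) : ℝ := ∑ p ∈ S, if p ∣ n then a p else 0

lemma ewh_bound (S : Finset ℕ) (a : ℕ → ℝ) (n : ℕ) : |ewh S a n| ≤ ∑ p ∈ S, |a p| := by
  unfold ewh
  refine (Finset.abs_sum_le_sum_abs _ _).trans (Finset.sum_le_sum fun p _ => ?_)
  split_ifs <;> simp

lemma ewh_int (P : Measure ℕ) [IsProbabilityMeasure P] (S : Finset ℕ) (a : ℕ → ℝ) :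
    Integrable (fun n => ewh S a n ^ 2) P := by
  refine Integrable.of_bound (C := (∑ p ∈ S, |a p|)^2) (measurable_from_top.aestronglyMeasurable) ?_
  refine Filter.Eventually.of_forall fun n => ?_
  rw [Real.norm_eq_abs, abs_pow]
  exact pow_le_pow_left₀ (abs_nonneg _) (ewh_bound S a n) 2

lemma ew_int_ite (P : Measure ℕ) [IsProbabilityMeasure P] (A : ℕ → Prop) [DecidablePred A] (c : ℝ) :
    Integrable (fun n => if A n then c else 0) P ∧ ∫ n, (if A n then c else 0) ∂P = c * P.real {n | A n} := by
  have e : (fun n => if A n then c else 0) = Set.indicator {n | A n} (fun _ => c) := by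
    ext n; simp [Set.indicator]
  rw [e]
  constructor
  · exact (integrable_const c).indicator MeasurableSet.of_discrete
  · rw [integral_indicator MeasurableSet.of_discrete]; simp [mul_comm]

lemma ew_second (P : Measure ℕ) [IsProbabilityMeasure P] (S : Finset ℕ) (hS : ∀ p ∈ S, p.Prime) (a : ℕ → ℝ)
    (ha : ∀ p ∈ S, |a p| ≤ 1) (δ : ℝ) (hδ0 : 0 ≤ δ) (hd : ∀ d : ℕ, P.real {n | d ∣ n} ≤ 1 / d)
    (hδ : ∀ p ∈ S, ∀ q ∈ S, p ≠ q → |P.real {n | p * q ∣ n} - 1 / ((p * q : ℕ):ℝ)| ≤ δ) :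
    ∫ n, ewh S a n ^ 2 ∂P ≤ ∑ p ∈ S, a p ^ 2 / p + (∑ p ∈ S, a p / p) ^ 2 + (S.card:ℝ)^2 * δ := by
  have e : ∀ n, ewh S a n ^ 2 = ∑ p ∈ S, ∑ q ∈ S, if (p ∣ n ∧ q ∣ n) then a p * a q else 0 := by
    intro n
    rw [sq, ewh, Finset.sum_mul_sum]
    refine Finset.sum_congr rfl fun p _ => Finset.sum_congr rfl fun q _ => ?_
    by_cases h1 : p ∣ n <;> by_cases h2 : q ∣ n <;> simp [h1, h2]
  simp_rw [e]
  rw [integral_finsetSum _ (fun p _ => integrable_finsetSum _ fun q _ => (ew_int_ite P (fun n => p ∣ n ∧ q ∣ n) _).1)]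
  have e2 : ∀ p ∈ S, ∫ n, (∑ q ∈ S, if (p ∣ n ∧ q ∣ n) then a p * a q else 0) ∂P
      = ∑ q ∈ S, a p * a q * P.real {n | p ∣ n ∧ q ∣ n} := by
    intro p _
    rw [integral_finsetSum _ (fun q _ => (ew_int_ite P (fun n => p ∣ n ∧ q ∣ n) _).1)]
    exact Finset.sum_congr rfl fun q _ => (ew_int_ite P (fun n => p ∣ n ∧ q ∣ n) _).2
  rw [Finset.sum_congr rfl e2]
  have key : ∀ p ∈ S, ∀ q ∈ S, a p * a q * P.real {n | p ∣ n ∧ q ∣ n} ≤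
      (a p / p) * (a q / q) + δ + (if p = q then a p ^ 2 / p else 0) := by
    intro p hp q hq
    have hp0 : (0:ℝ) < p := by exact_mod_cast (hS p hp).pos
    by_cases hpq : p = q
    · subst hpq
      simp only [and_self, if_true]
      have h1 : a p * a p * P.real {n | p ∣ n} ≤ a p * a p * (1 / p) :=
        mul_le_mul_of_nonneg_left (hd p) (mul_self_nonneg _)
      have h2 : 0 ≤ a p / p * (a p / p) := mul_self_nonneg _
      have h3 : a p * a p * (1 / p) = a p ^ 2 / p := by ring
      linarith
    · simp only [hpq, if_false, add_zero]
      have e3 : {n | p ∣ n ∧ q ∣ n} = {n | p * q ∣ n} := by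
        ext n
        simp only [Set.mem_ofPred_eq]
        constructor
        · rintro ⟨h1, h2⟩
          exact Nat.Coprime.mul_dvd_of_dvd_of_dvd ((Nat.coprime_primes (hS p hp) (hS q hq)).2 hpq) h1 h2
        · intro h; exact ⟨(Dvd.intro _ rfl).trans h, (Dvd.intro_left _ rfl).trans h⟩
      rw [e3]
      have h1 := hδ p hp q hq hpq
      have h2 : |a p * a q * (P.real {n | p * q ∣ n} - 1 / ((p * q : ℕ):ℝ))| ≤ δ := by
        rw [abs_mul, abs_mul]
        calc _ ≤ 1 * 1 * δ := by
              gcongr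
              · exact ha p hp
              · exact ha q hq
          _ = δ := by ring
      have h3 := (abs_le.1 h2).2
      have h4 : a p / p * (a q / q) = a p * a q * (1 / ((p * q : ℕ):ℝ)) := by push_cast; ring
      rw [h4]; linarith
  calc _ ≤ ∑ p ∈ S, ∑ q ∈ S, ((a p / p) * (a q / q) + δ + (if p = q then a p ^ 2 / p else 0)) :=
        Finset.sum_le_sum fun p hp => Finset.sum_le_sum fun q hq => key p hp q hq
    _ = _ := by
        have e9 : ∑ p ∈ S, ∑ q ∈ S, (if p = q then a p ^ 2 / (p:ℝ) else 0) = ∑ p ∈ S, a p ^ 2 / (p:ℝ) :=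
          Finset.sum_congr rfl (fun p hp => by rw [Finset.sum_ite_eq, if_pos hp])
        simp only [Finset.sum_add_distrib, Finset.sum_const, nsmul_eq_mul, ← Finset.mul_sum, ← Finset.sum_mul]
        rw [e9]
        ring

lemma ew_second2 (P : Measure ℕ) [IsProbabilityMeasure P] (S : Finset ℕ) (a : ℕ → ℝ)
    (hd : ∀ d : ℕ, P.real {n | d ∣ n} ≤ 1 / d)
    (hae : ∀ᵐ n ∂P, (S.filter (fun p => p ∣ n)).card ≤ 2) :
    ∫ n, ewh S a n ^ 2 ∂P ≤ 2 * ∑ p ∈ S, a p ^ 2 / p := by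
  have h1 : ∫ n, ewh S a n ^ 2 ∂P ≤ ∫ n, (∑ p ∈ S, if p ∣ n then 2 * a p ^ 2 else 0) ∂P := by
    refine integral_mono_ae (ewh_int P S a) (integrable_finsetSum _ fun q _ => (ew_int_ite P (fun n => q ∣ n) _).1) ?_
    filter_upwards [hae] with n hn
    simp only [ewh, ← Finset.sum_filter]
    have h2 := sq_sum_le_card_mul_sum_sq (s := S.filter (fun p => p ∣ n)) (f := a)
    refine h2.trans ?_
    rw [← Finset.mul_sum]
    have : ((S.filter (fun p => p ∣ n)).card : ℝ) ≤ 2 := by exact_mod_cast hn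
    exact mul_le_mul_of_nonneg_right this (Finset.sum_nonneg fun _ _ => sq_nonneg _)
  refine h1.trans ?_
  rw [integral_finsetSum _ (fun q _ => (ew_int_ite P (fun n => q ∣ n) _).1), Finset.mul_sum]
  refine Finset.sum_le_sum fun p _ => ?_
  rw [(ew_int_ite P (fun n => p ∣ n) _).2]
  calc _ ≤ 2 * a p ^ 2 * (1 / p) := mul_le_mul_of_nonneg_left (hd p) (by positivity)
    _ = _ := by ring

lemma ew_tail (f : ℕ → ℝ) (hf : IsAdditive f) (P : Measure ℕ) [IsProbabilityMeasure P] (K M : ℕ) (hK : 2 ≤ K)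
    (t e1 V : ℝ) (ht : 0 < t) (hd : ∀ d : ℕ, P.real {n | d ∣ n} ≤ 1 / d)
    (hnull : P.real {n | n = 0 ∨ ∃ p, p.Prime ∧ M ≤ p ∧ p ∣ n} = 0)
    (h1 : ∑ p ∈ (Finset.Ico K M).filter (fun p => p.Prime ∧ ¬ |f p| ≤ 1), (1:ℝ) / p ≤ e1)
    (hV : ∫ n, ewh ((Finset.Ico K M).filter (fun p => p.Prime ∧ |f p| ≤ 1)) f n ^ 2 ∂P ≤ V) :
    P.real {n | t < |f (ewrg K n)|} ≤ 2 / (K - 1 : ℝ) + e1 + V / t ^ 2 := by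
  set S := (Finset.Ico K M).filter (fun p => p.Prime ∧ |f p| ≤ 1) with hSdef
  set S2 := (Finset.Ico K M).filter (fun p => p.Prime ∧ ¬ |f p| ≤ 1) with hS2def
  have hsub : {n | t < |f (ewrg K n)|} ⊆ {n | n = 0 ∨ ∃ p, p.Prime ∧ M ≤ p ∧ p ∣ n} ∪
      ((⋃ p ∈ Finset.Ico K M, {n | p ^ 2 ∣ n}) ∪ ((⋃ p ∈ S2, {n | p ∣ n}) ∪ {n | t ^ 2 ≤ ewh S f n ^ 2})) := by
    intro n hn
    by_contra hcon
    simp only [Set.mem_union, Set.mem_iUnion, not_or, Set.mem_ofPred_eq] at hcon hn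
    obtain ⟨⟨h0, h2⟩, h3, h4, h5⟩ := hcon
    push Not at h2 h3 h4
    have hlt : ∀ p, p.Prime → p ∣ n → p < M := fun p hp hd => by
      by_contra hh; exact h2 p hp (not_lt.1 hh) hd
    have e := ew_f_rg f hf K n h0 (fun p hp hKp hdv => h3 p
      (Finset.mem_Ico.2 ⟨hKp, hlt p hp ((Dvd.intro_left _ (by ring : p * p = p ^ 2)).trans hdv)⟩) hdv)
    have e2 : f (ewrg K n) = ewh S f n := by
      rw [e, ewh, ← Finset.sum_filter]
      refine Finset.sum_congr ?_ fun _ _ => rfl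
      ext p
      simp only [hSdef, Finset.mem_filter, Finset.mem_Ico, Nat.mem_primeFactors]
      constructor
      · rintro ⟨⟨hp, hpn, _⟩, hK⟩
        have hl := hlt p hp hpn
        refine ⟨⟨⟨by omega, hl⟩, hp, ?_⟩, hpn⟩
        by_contra hc
        exact h4 p (by simp only [hS2def, Finset.mem_filter, Finset.mem_Ico]; exact ⟨⟨by omega, hl⟩, hp, hc⟩) hpn
      · rintro ⟨⟨⟨h6, _⟩, hp, _⟩, hpn⟩
        exact ⟨⟨hp, hpn, h0⟩, by omega⟩
    rw [e2] at hn
    apply h5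
    rw [← sq_abs (ewh S f n)]
    exact pow_le_pow_left₀ ht.le hn.le 2
  have b1 : P.real (⋃ p ∈ Finset.Ico K M, {n | p ^ 2 ∣ n}) ≤ 2 / (K - 1 : ℝ) := by
    refine (measureReal_biUnion_finset_le _ _).trans ?_
    have := sum_Ioo_inv_sq_le (α := ℝ) (K - 1) M
    have e3 : Finset.Ico K M = Finset.Ioo (K-1) M := by ext; simp; omega
    calc ∑ p ∈ Finset.Ico K M, P.real {n | p ^ 2 ∣ n} ≤ ∑ p ∈ Finset.Ico K M, (((p:ℝ))^2)⁻¹ := by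
          refine Finset.sum_le_sum fun p _ => ?_
          have := hd (p^2); push_cast at this; rwa [one_div] at this
      _ = ∑ p ∈ Finset.Ioo (K-1) M, (((p:ℝ))^2)⁻¹ := by rw [e3]
      _ ≤ _ := this
      _ ≤ 2 / (K - 1 : ℝ) := by
          have : (2:ℝ) ≤ K := by exact_mod_cast hK
          rw [Nat.cast_sub (by omega)]; push_cast
          apply div_le_div_of_nonneg_left <;> linarith
  have b2 : P.real (⋃ p ∈ S2, {n | p ∣ n}) ≤ e1 := by
    refine (measureReal_biUnion_finset_le _ _).trans (le_trans ?_ h1)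
    exact Finset.sum_le_sum fun p _ => hd p
  have b3 : P.real {n | t ^ 2 ≤ ewh S f n ^ 2} ≤ V / t ^ 2 := by
    rw [le_div_iff₀ (by positivity)]
    have := mul_meas_ge_le_integral_of_nonneg (μ := P) (f := fun n => ewh S f n ^ 2)
      (Filter.Eventually.of_forall fun n => sq_nonneg _) (ewh_int P S f) (t ^ 2)
    linarith
  calc _ ≤ _ := measureReal_mono hsub
    _ ≤ _ := measureReal_union_le _ _
    _ ≤ 0 + (P.real (⋃ p ∈ Finset.Ico K M, {n | p ^ 2 ∣ n}) + (P.real (⋃ p ∈ S2, {n | p ∣ n}) + P.real {n | t ^ 2 ≤ ewh S f n ^ 2})) := by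
        gcongr
        · exact hnull.le
        · refine (measureReal_union_le _ _).trans ?_
          gcongr
          exact measureReal_union_le _ _
    _ ≤ _ := by linarith


lemma ew_summ (f : ℕ → ℝ) (h : EWConv f) :
    Summable (fun n : ℕ => if IsPrimePow n then min 1 (f n ^ 2) / (n:ℝ) else 0) := by
  have h1 : Summable (fun n : ℕ => if n.Prime then min 1 (f n ^ 2) / (n:ℝ) else 0) := by
    have := h.1
    have h2 : Summable ((fun n : ℕ => min 1 (f n ^ 2) / (n:ℝ)) ∘ ((↑) : {p : ℕ | p.Prime} → ℕ)) := this
    rw [summable_subtype_iff_indicator] at h2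
    refine h2.congr fun n => ?_
    simp [Set.indicator]
  have h2 := ArithmeticFunction.vonMangoldt.summable_residueClass_non_primes_div (q := 1) (a := 0)
  have h3 := h2.mul_left (Real.log 2)⁻¹
  refine Summable.of_nonneg_of_le (fun n => by positivity) (fun n => ?_) (h1.add h3)
  have hlog2 : 0 < Real.log 2 := Real.log_pos (by norm_num)
  by_cases hp : n.Prime
  · simp [hp, hp.isPrimePow]
  · by_cases hpp : IsPrimePow n
    · simp only [hpp, hp, if_true, if_false, zero_add]
      have e : ArithmeticFunction.vonMangoldt.residueClass (0 : ZMod 1) n = Real.log (n.minFac) := by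
        unfold ArithmeticFunction.vonMangoldt.residueClass
        rw [Set.indicator_of_mem (by exact Subsingleton.elim _ _), ArithmeticFunction.vonMangoldt_apply, if_pos hpp]
      rw [e, ← mul_div_assoc]
      gcongr
      have h5 : Real.log 2 ≤ Real.log n.minFac := by
        apply Real.log_le_log (by norm_num)
        exact_mod_cast (Nat.minFac_prime hpp.ne_one).two_le
      rw [inv_mul_eq_div]
      exact (min_le_left _ _).trans ((one_le_div hlog2).2 h5)
    · simp only [hpp, hp, if_false, zero_add]
      exact mul_nonneg (by positivity) (div_nonneg (ArithmeticFunction.vonMangoldt.residueClass_nonneg _ _) (by positivity))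

lemma ew_eta_nonneg (f : ℕ → ℝ) (η : ℝ → ℝ) (h : EtaBound f η) (y : ℝ) : 0 ≤ η y :=
  h.2.1.le_of_tendsto h.2.2.1 y

lemma ew_eta_sum (f : ℕ → ℝ) (η : ℝ → ℝ) (hE : EWConv f) (h : EtaBound f η) (z : ℝ) (hz : 1 ≤ z) (S : Finset ℕ)
    (hS : ∀ p ∈ S, p.Prime ∧ z < p) : ∑ p ∈ S, min 1 (f p ^ 2) / (p:ℝ) ≤ η z := by
  refine le_trans ?_ (h.2.2.2.2 z hz)
  have hs : Summable (fun n : ℕ => if IsPrimePow n ∧ z < (n:ℝ) then min 1 (f n ^ 2) / (n:ℝ) else 0) := by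
    refine Summable.of_nonneg_of_le (fun n => by positivity) (fun n => ?_) (ew_summ f hE)
    by_cases h1 : IsPrimePow n <;> by_cases h2 : z < (n:ℝ) <;> simp [h1, h2]
    positivity
  refine le_trans (le_of_eq ?_) (hs.sum_le_tsum S (fun n _ => by positivity))
  refine Finset.sum_congr rfl fun p hp => ?_
  rw [if_pos ⟨(hS p hp).1.isPrimePow, (hS p hp).2⟩]

lemma ew_eta_sq (f : ℕ → ℝ) (η : ℝ → ℝ) (hE : EWConv f) (h : EtaBound f η) (z : ℝ) (hz : 1 ≤ z) (S : Finset ℕ)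
    (hS : ∀ p ∈ S, p.Prime ∧ z < p ∧ |f p| ≤ 1) : ∑ p ∈ S, f p ^ 2 / (p:ℝ) ≤ η z := by
  refine le_trans (le_of_eq ?_) (ew_eta_sum f η hE h z hz S (fun p hp => ⟨(hS p hp).1, (hS p hp).2.1⟩))
  refine Finset.sum_congr rfl fun p hp => ?_
  rw [min_eq_right]
  rw [← sq_abs]; exact pow_le_one₀ (abs_nonneg _) (hS p hp).2.2

lemma ew_eta_one (f : ℕ → ℝ) (η : ℝ → ℝ) (hE : EWConv f) (h : EtaBound f η) (z : ℝ) (hz : 1 ≤ z) (S : Finset ℕ)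
    (hS : ∀ p ∈ S, p.Prime ∧ z < p ∧ ¬ |f p| ≤ 1) : ∑ p ∈ S, (1:ℝ) / (p:ℝ) ≤ η z := by
  refine le_trans (le_of_eq ?_) (ew_eta_sum f η hE h z hz S (fun p hp => ⟨(hS p hp).1, (hS p hp).2.1⟩))
  refine Finset.sum_congr rfl fun p hp => ?_
  rw [min_eq_left]
  rw [← sq_abs]; exact one_le_pow₀ (not_le.1 (hS p hp).2.2).le

lemma ew_eta_lin (f : ℕ → ℝ) (η : ℝ → ℝ) (h : EtaBound f η) (z : ℝ) (hz : 1 ≤ z) (M : ℕ) (hM : z ≤ M) :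
    |∑ p ∈ (Finset.Ico (⌊z⌋₊ + 1) (M + 1)).filter (fun p => p.Prime ∧ |f p| ≤ 1), f p / (p:ℝ)| ≤ 2 * η z := by
  obtain ⟨l1, hl1, hb1⟩ := h.2.2.2.1 z hz
  obtain ⟨l2, hl2, hb2⟩ := h.2.2.2.1 M (hz.trans hM)
  have hsub := hl1.sub hl2
  have hc : Tendsto (fun N : ℕ => ∑ p ∈ (Finset.Ico (⌊z⌋₊ + 1) (M + 1)).filter (fun p => p.Prime ∧ |f p| ≤ 1), f p / (p:ℝ))
      atTop (𝓝 (l1 - l2)) := by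
    refine hsub.congr' ?_
    filter_upwards [eventually_ge_atTop (M + 1)] with N hN
    rw [sub_eq_iff_eq_add, ← Finset.sum_union]
    · refine Finset.sum_congr ?_ fun _ _ => rfl
      ext p
      simp only [Finset.mem_filter, Finset.mem_range, Finset.mem_union, Finset.mem_Ico, Nat.cast_lt]
      have : z < p ↔ ⌊z⌋₊ + 1 ≤ p := by rw [Nat.add_one_le_iff, Nat.floor_lt (by linarith)]
      constructor
      · rintro ⟨h1, h2, h3, h4⟩
        by_cases hp : M < p
        · exact Or.inr ⟨h1, h2, hp, h4⟩
        · exact Or.inl ⟨⟨this.1 h3, by omega⟩, h2, h4⟩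
      · rintro (⟨⟨h1, h5⟩, h2, h3⟩ | ⟨h1, h2, h3, h4⟩)
        · exact ⟨by omega, h2, this.2 h1, h3⟩
        · refine ⟨h1, h2, lt_of_le_of_lt hM (by exact_mod_cast h3), h4⟩
    · rw [Finset.disjoint_left]
      intro p hp hp2
      simp only [Finset.mem_filter, Finset.mem_Ico, Nat.cast_lt] at hp hp2
      omega
  have e := tendsto_nhds_unique tendsto_const_nhds hc
  rw [e]
  have h3 := h.2.1 hM
  calc |l1 - l2| ≤ |l1| + |l2| := abs_sub _ _
    _ ≤ _ := by linarith

lemma ew_charFun (f : ℕ → ℝ) (hf : IsAdditive f) (τ : ℝ) (N : ℕ) :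
    ∫ n, Complex.exp ((τ * f n : ℝ) * Complex.I) ∂(ewQ N) = 
    ∏ p ∈ (Finset.range N).filter Nat.Prime,
              ((1 - 1/(p:ℂ)) * ∑' ν : ℕ,
                Complex.exp ((τ * f (p ^ ν) : ℝ) * Complex.I) / (p : ℂ) ^ ν) := by
  set E : ℕ → ℂ := fun n => Complex.exp ((τ * f n : ℝ) * Complex.I) with hE
  have hEn : ∀ n, ‖E n‖ = 1 := fun n => Complex.norm_exp_ofReal_mul_I _
  have hEint : Integrable E (ewQ N) :=
    Integrable.of_bound (C := 1) (measurable_from_top.aestronglyMeasurable) (Filter.Eventually.of_forall fun n => (hEn n).le)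
  rw [integral_countable hEint]
  have h1 := (EulerProduct.summable_and_hasSum_smoothNumbers_prod_primesBelow_tsum (f := fun n => E n / n) 
    (by simp [hE, ew_f_one f hf])
    (by
      intro m n hmn
      rcases Nat.eq_zero_or_pos m with rfl | hm
      · simp
      rcases Nat.eq_zero_or_pos n with rfl | hn
      · simp
      simp only [hE, hf m n hm hn hmn]
      rw [show ((τ * (f m + f n) : ℝ) : ℂ) * Complex.I = ((τ * f m : ℝ):ℂ) * Complex.I + ((τ * f n : ℝ):ℂ) * Complex.I by push_cast; ring,
        Complex.exp_add]
      push_cast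
      rw [mul_div_mul_comm])
    (by
      intro p hp
      have : ∀ n : ℕ, ‖E (p ^ n) / ((p ^ n : ℕ):ℂ)‖ = ((p:ℝ)⁻¹) ^ n := by
        intro n; rw [norm_div, hEn]; simp
      simp_rw [this]
      have h2 : (2:ℝ) ≤ p := by exact_mod_cast hp.two_le
      exact summable_geometric_of_lt_one (by positivity) (inv_lt_one_of_one_lt₀ (by linarith))) N).2
  have h2 := h1.mul_left ((ewV N : ℝ) : ℂ)
  have e1 : ∀ n, (ewQ N).real {n} = ewq N n := by
    intro n; rw [ewQ_real, tsum_eq_single n]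
    · simp
    · intro b hb; simp [hb]
  have e2 : (∑' n, (ewQ N).real {n} • E n) = ∑' m : Nat.smoothNumbers N, ((ewV N : ℝ):ℂ) * (E m / (m:ℕ)) := by
    rw [tsum_subtype (Nat.smoothNumbers N) (fun m => ((ewV N : ℝ):ℂ) * (E m / (m:ℕ)))]
    refine tsum_congr fun n => ?_
    rw [e1, ewq]
    by_cases hn : n ∈ Nat.smoothNumbers N
    · rw [Set.indicator_of_mem hn, Set.indicator_of_mem hn, Complex.real_smul]; push_cast; ring
    · rw [Set.indicator_of_notMem hn, Set.indicator_of_notMem hn]; simp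
  rw [e2, h2.tsum_eq, ewV]
  push_cast
  rw [← Finset.prod_mul_distrib]
  refine Finset.prod_congr (by ext p; simp [Nat.mem_primesBelow]) fun p _ => ?_
  simp only [hE]
  push_cast
  rfl

lemma ew_limit (f : ℕ → ℝ) (hf : IsAdditive f) (μ : Measure ℝ) [IsProbabilityMeasure μ]
    (hμ : ∀ τ : ℝ, Tendsto (fun N : ℕ =>
            ∏ p ∈ (Finset.range N).filter Nat.Prime,
              ((1 - 1/(p:ℂ)) * ∑' ν : ℕ,
                Complex.exp ((τ * f (p ^ ν) : ℝ) * Complex.I) / (p : ℂ) ^ ν))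
          atTop (𝓝 (∫ y : ℝ, Complex.exp ((τ * y : ℝ) * Complex.I) ∂μ)))
    (F : Set ℝ) (hF : IsClosed F) (c : ℝ) (K : ℕ) (h : ∀ M, K ≤ M → c ≤ (ewQ M).real (f ⁻¹' F)) :
    c ≤ μ.real F := by
  have hfm : Measurable f := measurable_from_top
  have hpm : ∀ M, IsProbabilityMeasure ((ewQ M).map f) := fun M => Measure.isProbabilityMeasure_map hfm.aemeasurable
  let Pm : ℕ → ProbabilityMeasure ℝ := fun M => ⟨(ewQ M).map f, hpm M⟩
  let P0 : ProbabilityMeasure ℝ := ⟨μ, inferInstance⟩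
  have ht : Tendsto Pm atTop (𝓝 P0) := by
    apply ProbabilityMeasure.tendsto_of_tendsto_charFun
    intro τ
    have := hμ τ
    simp only [Pm, P0, ProbabilityMeasure.coe_mk, charFun_apply_real]
    convert this using 1
    · ext N
      rw [← ew_charFun f hf, integral_map hfm.aemeasurable (by fun_prop)]
      push_cast; rfl
    · push_cast; rfl
  have hl := ProbabilityMeasure.limsup_measure_closed_le_of_tendsto ht hF
  have hc : ENNReal.ofReal c ≤ limsup (fun i => (Pm i : Measure ℝ) F) atTop := by
    refine le_limsup_of_frequently_le ?_ 
    apply Eventually.frequently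
    filter_upwards [eventually_ge_atTop K] with M hM
    have h1 := h M hM
    have e : (Pm M : Measure ℝ) F = (ewQ M) (f ⁻¹' F) := Measure.map_apply hfm hF.measurableSet
    rw [e, ← ofReal_measureReal (by finiteness)]
    exact ENNReal.ofReal_le_ofReal h1
  have := hc.trans hl
  rw [Measure.real]
  exact (ENNReal.ofReal_le_iff_le_toReal (by finiteness)).1 this


lemma ew_tailQ (f : ℕ → ℝ) (hf : IsAdditive f) (η : ℝ → ℝ) (hE : EWConv f) (h : EtaBound f η) (z t : ℝ) (hz : 1 ≤ z)
    (ht : 0 < t) (M : ℕ) (hM : z ≤ M) :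
    (ewQ (M+1)).real {n | t < |f (ewrg (⌊z⌋₊ + 1) n)|} ≤ 2 / (⌊z⌋₊ : ℝ) + η z + (η z + 4 * η z ^ 2) / t ^ 2 := by
  have hfl : 1 ≤ ⌊z⌋₊ := (Nat.one_le_floor_iff z).2 hz
  have hgt : ∀ p : ℕ, ⌊z⌋₊ + 1 ≤ p → z < p := fun p hp => by
    rw [Nat.add_one_le_iff, Nat.floor_lt (by linarith)] at hp; exact hp
  have := ew_tail f hf (ewQ (M+1)) (⌊z⌋₊ + 1) (M+1) (by omega) t (η z) (η z + 4 * η z ^ 2) ht (ewQ_dvd_le (M+1)) ?_ ?_ ?_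
  · push_cast at this; rwa [add_sub_cancel_right] at this
  · rw [ewQ_real]
    have e : ∀ n, Set.indicator {n | n = 0 ∨ ∃ p, p.Prime ∧ M+1 ≤ p ∧ p ∣ n} (ewq (M+1)) n = 0 := by
      intro n
      by_cases hn : n ∈ {n | n = 0 ∨ ∃ p, p.Prime ∧ M+1 ≤ p ∧ p ∣ n}
      · rw [Set.indicator_of_mem hn, ewq, Set.indicator_of_notMem]
        intro hs
        rcases hn with h0 | ⟨p, hp, h1, h2⟩
        · exact Nat.ne_zero_of_mem_smoothNumbers hs h0
        · have := Nat.mem_smoothNumbers'.1 hs p hp h2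
          omega
      · exact Set.indicator_of_notMem hn _
    rw [tsum_congr e, tsum_zero]
  · refine ew_eta_one f η hE h z hz _ fun p hp => ?_
    simp only [Finset.mem_filter, Finset.mem_Ico] at hp
    exact ⟨hp.2.1, hgt p hp.1.1, hp.2.2⟩
  · set S := (Finset.Ico (⌊z⌋₊ + 1) (M+1)).filter (fun p => p.Prime ∧ |f p| ≤ 1) with hS
    have hSm : ∀ p ∈ S, p.Prime ∧ z < p ∧ |f p| ≤ 1 ∧ p < M + 1 := by
      intro p hp
      simp only [hS, Finset.mem_filter, Finset.mem_Ico] at hp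
      exact ⟨hp.2.1, hgt p hp.1.1, hp.2.2, hp.1.2⟩
    have h1 := ew_second (ewQ (M+1)) S (fun p hp => (hSm p hp).1) f (fun p hp => (hSm p hp).2.2.1) 0 le_rfl
      (ewQ_dvd_le (M+1)) (by
        intro p hp q hq _
        have hsm : ∀ p ∈ S, p ∈ Nat.smoothNumbers (M+1) := fun p hp => by
          rw [Nat.mem_smoothNumbers']
          intro r hr hrp
          rw [(Nat.prime_dvd_prime_iff_eq hr (hSm p hp).1).1 hrp]; exact (hSm p hp).2.2.2
        rw [ewQ_dvd _ _ (Nat.mul_mem_smoothNumbers (hsm p hp) (hsm q hq))]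
        simp)
    have h2 := ew_eta_sq f η hE h z hz S (fun p hp => ⟨(hSm p hp).1, (hSm p hp).2.1, (hSm p hp).2.2.1⟩)
    have h3 := ew_eta_lin f η h z hz M hM
    rw [← hS] at h3
    have h4 : (∑ p ∈ S, f p / (p:ℝ)) ^ 2 ≤ (2 * η z) ^ 2 := by
      rw [← sq_abs]; exact pow_le_pow_left₀ (abs_nonneg _) h3 2
    nlinarith

lemma ew_null (N : ℕ) (A : ℕ → Prop) (h : ∀ n, 0 < n → n ≤ N → ¬ A n) : (ewU N).real {n | A n} = 0 := by
  rw [ewU_real, Finset.filter_false_of_mem]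
  · simp
  · intro n hn; rw [Finset.mem_Ioc] at hn; exact h n hn.1 hn.2

lemma ew_tailU (f : ℕ → ℝ) (hf : IsAdditive f) (η : ℝ → ℝ) (hE : EWConv f) (h : EtaBound f η) (z t : ℝ) (hz : 1 ≤ z)
    (ht : 0 < t) (N Y : ℕ) (hN : 1 ≤ N) (hY : z ≤ Y) (hYN : Y ≤ N) (hY3 : N < (Y+1)^3) :
    (ewU N).real {n | t < |f (ewrg (⌊z⌋₊ + 1) n)|} ≤ 2 / (⌊z⌋₊ : ℝ) + η z +
      (2 * (η z + 4 * η z ^ 2 + (Y+1:ℝ)^2 / N) + 4 * η z) / t ^ 2 := by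
  have := ewU_prob N hN
  have hfl : 1 ≤ ⌊z⌋₊ := (Nat.one_le_floor_iff z).2 hz
  have hgt : ∀ p : ℕ, ⌊z⌋₊ + 1 ≤ p → z < p := fun p hp => by
    rw [Nat.add_one_le_iff, Nat.floor_lt (by linarith)] at hp; exact hp
  have hzY : ⌊z⌋₊ ≤ Y := Nat.floor_le_of_le hY
  have := ew_tail f hf (ewU N) (⌊z⌋₊ + 1) (N+1) (by omega) t (η z)
    (2 * (η z + 4 * η z ^ 2 + (Y+1:ℝ)^2 / N) + 4 * η z) ht (fun d => (ewU_dvd N d hN).1) ?_ ?_ ?_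
  · push_cast at this; rwa [add_sub_cancel_right] at this
  · apply ew_null
    rintro n h0 hn (h1 | ⟨p, hp, h1, h2⟩)
    · omega
    · have := Nat.le_of_dvd h0 h2; omega
  · refine ew_eta_one f η hE h z hz _ fun p hp => ?_
    simp only [Finset.mem_filter, Finset.mem_Ico] at hp
    exact ⟨hp.2.1, hgt p hp.1.1, hp.2.2⟩
  · set S := (Finset.Ico (⌊z⌋₊ + 1) (N+1)).filter (fun p => p.Prime ∧ |f p| ≤ 1) with hS
    set S1 := (Finset.Ico (⌊z⌋₊ + 1) (Y+1)).filter (fun p => p.Prime ∧ |f p| ≤ 1) with hS1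
    set S2 := (Finset.Ico (Y+1) (N+1)).filter (fun p => p.Prime ∧ |f p| ≤ 1) with hS2
    have hSu : S = S1 ∪ S2 := by
      ext p; simp only [hS, hS1, hS2, Finset.mem_filter, Finset.mem_Ico, Finset.mem_union]
      constructor
      · rintro ⟨h1, h2⟩
        by_cases hp : p < Y + 1
        · left; exact ⟨⟨h1.1, hp⟩, h2⟩
        · right; exact ⟨⟨by omega, h1.2⟩, h2⟩
      · rintro (⟨h1, h2⟩ | ⟨h1, h2⟩) <;> exact ⟨by omega, h2⟩
    have hSd : Disjoint S1 S2 := by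
      rw [Finset.disjoint_left]
      intro p hp hp2
      simp only [hS1, hS2, Finset.mem_filter, Finset.mem_Ico] at hp hp2
      omega
    have hSm : ∀ p ∈ S1, p.Prime ∧ z < p ∧ |f p| ≤ 1 := by
      intro p hp
      simp only [hS1, Finset.mem_filter, Finset.mem_Ico] at hp
      exact ⟨hp.2.1, hgt p hp.1.1, hp.2.2⟩
    have hSm2 : ∀ p ∈ S2, p.Prime ∧ z < p ∧ |f p| ≤ 1 := by
      intro p hp
      simp only [hS2, Finset.mem_filter, Finset.mem_Ico] at hp
      exact ⟨hp.2.1, hgt p (by omega), hp.2.2⟩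
    have h1 := ew_second (ewU N) S1 (fun p hp => (hSm p hp).1) f (fun p hp => (hSm p hp).2.2) (1 / N) (by positivity)
      (fun d => (ewU_dvd N d hN).1) (fun p _ q _ _ => (ewU_dvd N (p * q) hN).2)
    have h2 := ew_eta_sq f η hE h z hz S1 hSm
    have h3 := ew_eta_lin f η h z hz Y hY
    rw [← hS1] at h3
    have h4 : (∑ p ∈ S1, f p / (p:ℝ)) ^ 2 ≤ (2 * η z) ^ 2 := by
      rw [← sq_abs]; exact pow_le_pow_left₀ (abs_nonneg _) h3 2
    have h5 : (S1.card:ℝ)^2 * (1 / N) ≤ (Y+1:ℝ)^2 / N := by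
      rw [mul_one_div]
      have : (S1.card:ℝ) ≤ Y + 1 := by
        have : S1.card ≤ Y + 1 := (Finset.card_filter_le _ _).trans (by rw [Nat.card_Ico]; omega)
        exact_mod_cast this
      gcongr
    have h6 := ew_second2 (ewU N) S2 f (fun d => (ewU_dvd N d hN).1) (by
      rw [ae_iff, ← measureReal_eq_zero_iff]
      apply ew_null
      intro n hn0 hn hc
      apply hc
      by_contra hc2
      have h8 : ∏ p ∈ S2.filter (fun p => p ∣ n), p ∣ n :=
        Finset.prod_primes_dvd n (fun p hp => ((hSm2 p (Finset.mem_filter.1 hp).1).1).prime)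
          (fun p hp => (Finset.mem_filter.1 hp).2)
      have h9 : (Y+1) ^ (S2.filter (fun p => p ∣ n)).card ≤ ∏ p ∈ S2.filter (fun p => p ∣ n), p := by
        apply Finset.pow_card_le_prod
        intro p hp
        have := (Finset.mem_filter.1 hp).1
        simp only [hS2, Finset.mem_filter, Finset.mem_Ico] at this
        exact this.1.1
      have h10 : (Y+1)^3 ≤ (Y+1) ^ (S2.filter (fun p => p ∣ n)).card := Nat.pow_le_pow_right (by omega) (by omega)
      have h11 := Nat.le_of_dvd hn0 h8
      omega)
    have h7 := ew_eta_sq f η hE h z hz S2 hSm2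
    have h8 : ∫ n, ewh S f n ^ 2 ∂(ewU N) ≤ ∫ n, (2 * ewh S1 f n ^ 2 + 2 * ewh S2 f n ^ 2) ∂(ewU N) := by
      refine integral_mono (ewh_int _ _ _) (((ewh_int _ _ _).const_mul 2).add ((ewh_int _ _ _).const_mul 2)) ?_
      intro n
      have : ewh S f n = ewh S1 f n + ewh S2 f n := by
        unfold ewh; rw [hSu, Finset.sum_union hSd]
      simp only [this]
      nlinarith [sq_nonneg (ewh S1 f n - ewh S2 f n)]
    rw [integral_add ((ewh_int _ _ _).const_mul 2) ((ewh_int _ _ _).const_mul 2), integral_const_mul, integral_const_mul] at h8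
    nlinarith


lemma ew_combine (f : ℕ → ℝ) (hf : IsAdditive f) (μ : Measure ℝ) [IsProbabilityMeasure μ]
    (hμ : ∀ τ : ℝ, Tendsto (fun N : ℕ =>
            ∏ p ∈ (Finset.range N).filter Nat.Prime,
              ((1 - 1/(p:ℂ)) * ∑' ν : ℕ,
                Complex.exp ((τ * f (p ^ ν) : ℝ) * Complex.I) / (p : ℂ) ^ ν))
          atTop (𝓝 (∫ y : ℝ, Complex.exp ((τ * y : ℝ) * Complex.I) ∂μ)))
    (P : Measure ℕ) [IsProbabilityMeasure P] (K : ℕ) (t δ1 δ2 δ3 Q : ℝ) (h0 : P.real {0} = 0) (ht : 0 < t) (hQ0 : 0 ≤ Q)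
    (h1 : ∀ B : Set ℕ, P.real (ewsm K ⁻¹' B) ≤ (ewQ K).real B + δ1)
    (h2 : P.real {n | t < |f (ewrg K n)|} ≤ δ2)
    (h3 : ∀ M, K + 1 ≤ M → (ewQ M).real {n | t < |f (ewrg K n)|} ≤ δ3)
    (hQ : ∀ z, μ.real (Set.Iic (z + t)) - μ.real (Set.Iic z) ≤ Q) (y : ℝ) :
    |P.real {n | f n ≤ y} - μ.real (Set.Iic y)| ≤ 3 * Q + (δ1 + δ2 + δ3) := by
  have hP := ew_cmp f hf P K t δ1 δ2 h0 h1 h2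
  have hM : ∀ M, K + 1 ≤ M → _ := fun M hM => ew_cmp f hf (ewQ M) K t 0 δ3 (by
      rw [ewQ_real]
      rw [tsum_eq_single 0]
      · rw [ewq]
        by_cases h : 0 ∈ Nat.smoothNumbers M
        · exact absurd rfl (Nat.ne_zero_of_mem_smoothNumbers h)
        · simp [h]
      · intro b hb; simp [hb]) (fun B => by rw [add_zero]; exact ewQ_map_sm K M (by omega) B) (h3 M hM)
  have a1 : ∀ y, (ewQ K).real {n | f n ≤ y} - δ3 ≤ μ.real (Set.Iic (y + t)) := by
    intro y
    refine ew_limit f hf μ hμ _ isClosed_Iic _ (K+1) fun M hKM => ?_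
    have := (hM M hKM y).2
    have e : f ⁻¹' Set.Iic (y + t) = {n | f n ≤ y + t} := rfl
    rw [e]; linarith
  have a2 : ∀ y, μ.real (Set.Iic y) ≤ (ewQ K).real {n | f n ≤ y + 2 * t} + δ3 := by
    intro y
    have := ew_limit f hf μ hμ (Set.Ici (y + t)) isClosed_Ici (1 - (ewQ K).real {n | f n ≤ y + 2 * t} - δ3) (K+1) (by
      intro M hKM
      have h4 := (hM M hKM (y + t)).1
      have e : f ⁻¹' Set.Ici (y + t) = {n | f n < y + t}ᶜ := by ext n; simp
      rw [e, probReal_compl_eq_one_sub MeasurableSet.of_discrete]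
      have h5 : (ewQ M).real {n | f n < y + t} ≤ (ewQ M).real {n | f n ≤ y + t} := 
        measureReal_mono (fun n hn => by
          simp only [Set.mem_ofPred_eq] at *; linarith)
      rw [show y + t + t = y + 2 * t by ring] at h4
      linarith)
    have h6 : μ.real (Set.Ici (y + t)) ≤ 1 - μ.real (Set.Iic y) := by
      rw [← probReal_compl_eq_one_sub measurableSet_Iic]
      refine measureReal_mono ?_
      intro u hu; simp only [Set.mem_Ici, Set.mem_compl_iff, Set.mem_Iic, not_le] at *; linarith
    linarith
  have b1 := (hP y).1
  have b2 := a1 (y + t)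
  have b3 := hQ y
  have b4 := hQ (y + t)
  have c1 := a2 (y - 3 * t)
  have c2 := (hP (y - 3 * t + 2 * t)).2
  have c3 := hQ (y - 3 * t)
  have c4 := hQ (y - 3 * t + t)
  have c5 := hQ (y - 3 * t + t + t)
  rw [show y - 3 * t + 2 * t + t = y by ring] at c2
  rw [show y - 3 * t + t + t + t = y by ring] at c5
  rw [abs_le]
  constructor <;> linarith

lemma ew_floor_half (u : ℝ) (hu : 1 ≤ u) : u / 2 ≤ (⌊u⌋₊ : ℝ) ∧ (⌊u⌋₊ : ℝ) ≤ u := by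
  have h1 := Nat.lt_floor_add_one u
  have h2 := Nat.floor_le (show 0 ≤ u by linarith)
  have h3 : (1:ℝ) ≤ ⌊u⌋₊ := by exact_mod_cast (Nat.one_le_floor_iff u).2 hu
  constructor <;> linarith

lemma ew_delta1 (x z s w : ℝ) (hw : 0 < w) (hw2 : w ≤ 1/50) (hs : 1 / w ^ 11 ≤ s) (hx : x = s ^ 48)
    (hz : 1 ≤ z) (hlz : Real.log z = w ^ 6 * Real.log x) (hlz2 : 2 ≤ Real.log z) (B : Set ℕ) :
    (ewU ⌊x⌋₊).real (ewsm (⌊z⌋₊ + 1) ⁻¹' B) ≤ (ewQ (⌊z⌋₊ + 1)).real B + 3 * w := by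
  have hs50 : 50 ≤ s := by
    refine le_trans ?_ hs
    rw [le_div_iff₀ (by positivity)]
    have : w ^ 11 ≤ (1/50) ^ 11 := pow_le_pow_left₀ hw.le hw2 11
    norm_num at this ⊢; linarith
  have hs0 : 0 < s := by linarith
  have hsw : 1 / s ≤ w := by
    rw [div_le_iff₀ hs0]
    rw [div_le_iff₀ (by positivity)] at hs
    have : w ^ 11 ≤ w := by
      calc w ^ 11 = w * w ^ 10 := by ring
        _ ≤ w * 1 := by gcongr; exact pow_le_one₀ hw.le (by linarith)
        _ = w := mul_one w
    nlinarith
  have p24 : 1 ≤ s ^ 24 := one_le_pow₀ (by linarith)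
  have p48 : 1 ≤ x := by rw [hx]; exact one_le_pow₀ (by linarith)
  have p3 : 50 ^ 3 ≤ s ^ 3 := pow_le_pow_left₀ (by norm_num) hs50 3
  have hN := ew_floor_half x p48
  have hA := ew_floor_half (s ^ 24) p24
  have hQ := ew_floor_half (s ^ 3) (by linarith)
  have hN1 : 1 ≤ ⌊x⌋₊ := (Nat.one_le_floor_iff x).2 p48
  have hA1 : 1 ≤ ⌊s ^ 24⌋₊ := (Nat.one_le_floor_iff _).2 p24
  have hQ1 : 2 ≤ ⌊s ^ 3⌋₊ := by rw [Nat.le_floor_iff (by positivity)]; push_cast; linarith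
  have hzf := ew_floor_half z hz
  have hz1 : 1 ≤ ⌊z⌋₊ := (Nat.one_le_floor_iff _).2 hz
  have hlx : Real.log x = 48 * Real.log s := by rw [hx, Real.log_pow]; norm_num
  have hls : 0 < Real.log s := Real.log_pos (by linarith)
  have hmert : ∑ p ∈ Nat.primesBelow (⌊z⌋₊ + 1), Real.log p / p ≤ 2 * (w ^ 6 * Real.log x) := by
    refine (ew_mertens _ hz1).trans ?_
    have h1 : Real.log (⌊z⌋₊ : ℝ) ≤ Real.log z := Real.log_le_log (by exact_mod_cast hz1) hzf.2
    have h2 : Real.log 4 ≤ 2 := by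
      rw [show (4:ℝ) = 2 ^ 2 by norm_num, Real.log_pow]
      have := Real.log_two_lt_d9
      push_cast; linarith
    linarith
  have hlQ : 2 * Real.log s ≤ Real.log (⌊s ^ 3⌋₊ : ℝ) := by
    have : 2 * Real.log s = Real.log (s ^ 2) := by rw [Real.log_pow]; norm_num
    rw [this]
    apply Real.log_le_log (by positivity)
    nlinarith [sq_nonneg s, mul_nonneg (sq_nonneg s) (show 0 ≤ s - 50 by linarith)]
  have hlA : 24 * Real.log s ≤ Real.log ((⌊s ^ 24⌋₊ : ℝ) + 1) := by
    have : 24 * Real.log s = Real.log (s ^ 24) := by rw [Real.log_pow]; norm_num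
    rw [this]
    apply Real.log_le_log (by positivity)
    exact (Nat.lt_floor_add_one _).le
  have hw6 : w ^ 6 ≤ w / 50 ^ 5 := by
    have : w ^ 5 ≤ (1/50) ^ 5 := pow_le_pow_left₀ hw.le hw2 5
    calc w ^ 6 = w * w ^ 5 := by ring
      _ ≤ w * (1/50) ^ 5 := by gcongr
      _ = _ := by ring
  have hb := ewU_sm_bound (⌊z⌋₊ + 1) ⌊s ^ 3⌋₊ ⌊x⌋₊ ⌊s ^ 24⌋₊ hN1 hQ1 (48 * w ^ 6) (by positivity) (by nlinarith) (by
    refine hmert.trans ?_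
    rw [hlx]
    nlinarith [pow_pos hw 6]) B
  have hL := ewU_sm_large (⌊z⌋₊ + 1) ⌊x⌋₊ ⌊s ^ 24⌋₊ hN1 hA1
  have hL2 : (ewU ⌊x⌋₊).real {n | ⌊s ^ 24⌋₊ < ewsm (⌊z⌋₊ + 1) n} ≤ 8 * w ^ 6 := by
    refine hL.trans ?_
    rw [div_le_iff₀ (by linarith)]
    calc _ ≤ 2 * (2 * (w ^ 6 * (48 * Real.log s))) := by rw [← hlx]; gcongr
      _ = 8 * w ^ 6 * (24 * Real.log s) := by ring
      _ ≤ _ := by gcongr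
  have hAQ : (⌊s ^ 24⌋₊ : ℝ) * ((⌊s ^ 3⌋₊ : ℝ) ^ 4 / ⌊x⌋₊) ≤ w := by
    calc _ ≤ s ^ 24 * ((s ^ 3) ^ 4 / (x / 2)) := by
          gcongr
          · exact hA.2
          · exact hQ.2
          · exact hN.1
      _ = 2 / s ^ 12 := by rw [hx]; field_simp
      _ = (2 / s ^ 11) * (1 / s) := by field_simp
      _ ≤ 1 * w := by
          gcongr
          rw [div_le_one (by positivity)]
          calc (2:ℝ) ≤ 50 ^ 11 := by norm_num
            _ ≤ s ^ 11 := pow_le_pow_left₀ (by norm_num) hs50 11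
      _ = w := one_mul w
  nlinarith


lemma ew_delta2 (f : ℕ → ℝ) (hf : IsAdditive f) (η : ℝ → ℝ) (hE : EWConv f) (h : EtaBound f η)
    (x z s w T : ℝ) (hw : 0 < w) (hw2 : w ≤ 1/50) (hs : 1 / w ^ 11 ≤ s) (hx : x = s ^ 48)
    (hz : 1 / w ^ 6 ≤ z) (hz2 : z ≤ s ^ 8) (hT : 3 ≤ T) (hT2 : T ≤ s ^ 2) (hη : T ^ 2 * η z ≤ w ^ 2) :
    (ewU ⌊x⌋₊).real {n | 1 / T < |f (ewrg (⌊z⌋₊ + 1) n)|} ≤ w ∧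
    ∀ M, ⌊z⌋₊ + 1 + 1 ≤ M → (ewQ M).real {n | 1 / T < |f (ewrg (⌊z⌋₊ + 1) n)|} ≤ w := by
  have hs50 : 50 ≤ s := by
    refine le_trans ?_ hs
    rw [le_div_iff₀ (by positivity)]
    have : w ^ 11 ≤ (1/50) ^ 11 := pow_le_pow_left₀ hw.le hw2 11
    norm_num at this ⊢; linarith
  have hs0 : 0 < s := by linarith
  have hsw : 1 / s ≤ w := by
    rw [div_le_iff₀ hs0]
    rw [div_le_iff₀ (by positivity)] at hs
    have : w ^ 11 ≤ w := by
      calc w ^ 11 = w * w ^ 10 := by ring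
        _ ≤ w * 1 := by gcongr; exact pow_le_one₀ hw.le (by linarith)
        _ = w := mul_one w
    nlinarith
  have hw6 : w ^ 6 ≤ w / 50 ^ 5 := by
    have : w ^ 5 ≤ (1/50) ^ 5 := pow_le_pow_left₀ hw.le hw2 5
    calc w ^ 6 = w * w ^ 5 := by ring
      _ ≤ w * (1/50) ^ 5 := by gcongr
      _ = _ := by ring
  have hz1 : 1 ≤ z := by
    refine le_trans ?_ hz
    rw [le_div_iff₀ (by positivity), one_mul]
    exact pow_le_one₀ hw.le (by linarith)
  have hT0 : 0 < T := by linarith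
  have hη0 := ew_eta_nonneg f η h z
  have hη1 : η z ≤ w ^ 2 := by
    have hT1 : 1 ≤ T ^ 2 := one_le_pow₀ (by linarith)
    exact (le_mul_of_one_le_left hη0 hT1).trans hη
  have hη2 : T ^ 2 * (4 * η z ^ 2) ≤ 4 * w ^ 2 := by
    have : T ^ 2 * (4 * η z ^ 2) = 4 * (T ^ 2 * η z) * η z := by ring
    rw [this]
    have : η z ≤ 1 := hη1.trans (pow_le_one₀ hw.le (by linarith))
    calc 4 * (T ^ 2 * η z) * η z ≤ 4 * w ^ 2 * 1 := by gcongr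
      _ = _ := by ring
  have hzf := ew_floor_half z hz1
  have hK : 2 / (⌊z⌋₊ : ℝ) ≤ 4 * w ^ 6 := by
    calc 2 / (⌊z⌋₊ : ℝ) ≤ 2 / (z / 2) := by gcongr; exact hzf.1
      _ ≤ 2 / ((1 / w ^ 6) / 2) := by gcongr
      _ = 4 * w ^ 6 := by field_simp; norm_num
  have ht : (1 / T) ^ 2 = 1 / T ^ 2 := by rw [div_pow, one_pow]
  have hww : w ^ 2 ≤ w / 50 := by nlinarith
  constructor
  · have p48 : 1 ≤ x := by rw [hx]; exact one_le_pow₀ (by linarith)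
    have hN := ew_floor_half x p48
    have hN1 : 1 ≤ ⌊x⌋₊ := (Nat.one_le_floor_iff x).2 p48
    have p16 : 1 ≤ s ^ 16 := one_le_pow₀ (by linarith)
    have p8 : 50 ≤ s ^ 8 := by
      calc (50:ℝ) ≤ 50 ^ 8 := by norm_num
        _ ≤ s ^ 8 := pow_le_pow_left₀ (by norm_num) hs50 8
    have hY := ew_floor_half (s ^ 16) p16
    have e16 : s ^ 16 = s ^ 8 * s ^ 8 := by ring
    have hYN : ⌊s ^ 16⌋₊ ≤ ⌊x⌋₊ := by
      apply Nat.floor_le_floor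
      rw [hx]; exact pow_le_pow_right₀ (by linarith) (by norm_num)
    have hY3 : ⌊x⌋₊ < (⌊s ^ 16⌋₊ + 1) ^ 3 := by
      rw [Nat.floor_lt (by linarith)]
      push_cast
      calc x = (s ^ 16) ^ 3 := by rw [hx]; ring
        _ < _ := pow_lt_pow_left₀ (Nat.lt_floor_add_one _) (by positivity) (by norm_num)
    have hb := ew_tailU f hf η hE h z (1 / T) hz1 (by positivity) ⌊x⌋₊ ⌊s ^ 16⌋₊ hN1 (by nlinarith) hYN hY3
    rw [ht, div_div_eq_mul_div, div_one] at hb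
    have hYY : ((⌊s ^ 16⌋₊ : ℝ) + 1) ^ 2 / ⌊x⌋₊ * T ^ 2 ≤ w / 50 := by
      calc _ ≤ (s ^ 16 + s ^ 16) ^ 2 / (x / 2) * (s ^ 2) ^ 2 := by
            gcongr
            · exact hY.2
            · exact hN.1
        _ = 8 / s ^ 12 := by rw [hx]; field_simp; norm_num
        _ = (8 / s ^ 11) * (1 / s) := by field_simp
        _ ≤ (1 / 50) * w := by
            refine mul_le_mul ?_ hsw (by positivity) (by norm_num)
            rw [div_le_iff₀ (by positivity)]
            have : (50:ℝ) ^ 11 ≤ s ^ 11 := pow_le_pow_left₀ (by norm_num) hs50 11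
            norm_num at this; linarith
        _ = w / 50 := by ring
    refine hb.trans ?_
    set X := ((⌊s ^ 16⌋₊ : ℝ) + 1) ^ 2 / ⌊x⌋₊
    have : (2 * (η z + 4 * η z ^ 2 + X) + 4 * η z) * T ^ 2 =
      6 * (T ^ 2 * η z) + 2 * (T ^ 2 * (4 * η z ^ 2)) + 2 * (X * T ^ 2) := by ring
    rw [this]
    linarith
  · intro M hM
    obtain ⟨m, rfl⟩ : ∃ m, M = m + 1 := ⟨M - 1, by omega⟩
    have hb := ew_tailQ f hf η hE h z (1 / T) hz1 (by positivity) m (by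
      have h1 := Nat.lt_floor_add_one z
      have h2 : ((⌊z⌋₊ : ℝ) + 1) ≤ m := by exact_mod_cast (by omega : ⌊z⌋₊ + 1 ≤ m)
      linarith)
    rw [ht, div_div_eq_mul_div, div_one] at hb
    refine hb.trans ?_
    have : (η z + 4 * η z ^ 2) * T ^ 2 = (T ^ 2 * η z) + (T ^ 2 * (4 * η z ^ 2)) := by ring
    rw [this]
    linarith

lemma ew_Fx (f : ℕ → ℝ) (x : ℝ) (hx : 1 ≤ x) (y : ℝ) : |Fx f x y - (ewU ⌊x⌋₊).real {n | f n ≤ y}| ≤ 1 / x ∧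
    0 ≤ Fx f x y ∧ Fx f x y ≤ 1 := by
  have hN1 : 1 ≤ ⌊x⌋₊ := (Nat.one_le_floor_iff x).2 hx
  have hN : (0:ℝ) < ⌊x⌋₊ := by exact_mod_cast hN1
  have := ewU_prob _ hN1
  set U := (ewU ⌊x⌋₊).real {n | f n ≤ y} with hU
  have hU0 : 0 ≤ U := measureReal_nonneg
  have hU1 : U ≤ 1 := measureReal_le_one
  have e : Fx f x y = U * (⌊x⌋₊ / x) := by
    rw [hU, ewU_real, Fx]
    have e2 : Finset.Icc 1 ⌊x⌋₊ = Finset.Ioc 0 ⌊x⌋₊ := by ext; simp; omega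
    rw [e2]
    simp only [Set.mem_ofPred_eq]
    field_simp
  have h1 := Nat.lt_floor_add_one x
  have h2 := Nat.floor_le (show 0 ≤ x by linarith)
  have hx0 : 0 < x := by linarith
  have h3 : (⌊x⌋₊ : ℝ) / x ≤ 1 := (div_le_one hx0).2 h2
  have h4 : 1 - 1 / x ≤ (⌊x⌋₊ : ℝ) / x := by
    rw [le_div_iff₀ hx0, sub_mul, div_mul_cancel₀ _ hx0.ne']; linarith
  have h5 : 0 ≤ (⌊x⌋₊ : ℝ) / x := by positivity
  have h6 : 0 ≤ 1 / x := by positivity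
  rw [e]
  refine ⟨?_, by positivity, by nlinarith⟩
  rw [abs_le]; constructor <;> nlinarith

lemma ew_main (f : ℕ → ℝ) (η : ℝ → ℝ) (μ : Measure ℝ) (hf : IsAdditive f) (hE : EWConv f) (h : EtaBound f η)
    (hpr : IsProbabilityMeasure μ) 
    (hμ : ∀ τ : ℝ, Tendsto (fun N : ℕ =>
            ∏ p ∈ (Finset.range N).filter Nat.Prime,
              ((1 - 1/(p:ℂ)) * ∑' ν : ℕ,
                Complex.exp ((τ * f (p ^ ν) : ℝ) * Complex.I) / (p : ℂ) ^ ν))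
          atTop (𝓝 (∫ y : ℝ, Complex.exp ((τ * y : ℝ) * Complex.I) ∂μ)))
    (R T x ε : ℝ) (hR : 3 ≤ R) (hT : 3 ≤ T) (hx : 3 ≤ x) (hε1 : 1 / Real.sqrt (Real.log x) < ε) 
    (hH : 2 * Real.log (Real.log R) + T^2 * η R / 2 + 7 ≤ Real.log (1/ε) / 4)
    (hη : T^2 * η (x ^ ε) ≤ ε ^ ((1:ℝ)/3)) (y : ℝ) :
    |Fx f x y - (μ (Set.Iic y)).toReal| ≤
              10 * ((⨆ z : ℝ, ((μ (Set.Iic (z + 1/T))).toReal - (μ (Set.Iic z)).toReal))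
                + ε ^ ((1:ℝ)/6) * Real.log (T * Bf f R / ε) + η R) := by
  set Q := ⨆ z : ℝ, ((μ (Set.Iic (z + 1/T))).toReal - (μ (Set.Iic z)).toReal) with hQdef
  have hT0 : 0 < T := by linarith
  have hQt : ∀ z, 0 ≤ (μ (Set.Iic (z + 1/T))).toReal - (μ (Set.Iic z)).toReal := by
    intro z
    rw [sub_nonneg]
    exact measureReal_mono (μ := μ) (Set.Iic_subset_Iic.2 (by have : 0 < 1 / T := by positivity
                                                              linarith))
  have hQ0 : 0 ≤ Q := Real.iSup_nonneg hQt
  have hQ : ∀ z, (μ (Set.Iic (z + 1/T))).toReal - (μ (Set.Iic z)).toReal ≤ Q := by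
    intro z
    refine le_ciSup (f := fun z => (μ (Set.Iic (z + 1/T))).toReal - (μ (Set.Iic z)).toReal) ⟨1, ?_⟩ z
    rintro _ ⟨u, rfl⟩
    have h1 : μ.real (Set.Iic (u + 1/T)) ≤ 1 := measureReal_le_one
    have h2 : 0 ≤ μ.real (Set.Iic u) := measureReal_nonneg
    simp only [Measure.real] at h1 h2
    linarith
  have hηR := ew_eta_nonneg f η h R
  have hlx0 : 0 < Real.log x := Real.log_pos (by linarith)
  have hε0 : 0 < ε := lt_of_le_of_lt (by positivity) hε1
  have hF := ew_Fx f x (by linarith) y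
  have hm1 : μ.real (Set.Iic y) ≤ 1 := measureReal_le_one
  have hm0 : 0 ≤ μ.real (Set.Iic y) := measureReal_nonneg
  change |Fx f x y - μ.real (Set.Iic y)| ≤ _
  -- bound on ε
  have hlε : Real.log ε ≤ -28 := by
    have h1 : 1 ≤ Real.log R := by
      rw [Real.le_log_iff_exp_le (by linarith)]
      have := Real.exp_one_lt_d9; linarith
    have h2 := Real.log_nonneg h1
    have h3 : 0 ≤ T ^ 2 * η R / 2 := by positivity
    rw [one_div, Real.log_inv] at hH
    linarith
  set w := ε ^ ((1:ℝ)/6) with hwdef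
  have hw : 0 < w := Real.rpow_pos_of_pos hε0 _
  have hw6 : w ^ 6 = ε := by
    rw [hwdef, ← Real.rpow_natCast, ← Real.rpow_mul hε0.le]; norm_num
  have hw2' : w ^ 2 = ε ^ ((1:ℝ)/3) := by
    rw [hwdef, ← Real.rpow_natCast, ← Real.rpow_mul hε0.le]; norm_num
  have hlw : 6 * Real.log w = Real.log ε := by rw [← hw6, Real.log_pow]; norm_num
  have hw50 : w ≤ 1/50 := by
    have h1 : Real.log w ≤ -4 := by linarith
    have h2 : w ≤ Real.exp (-4) := (Real.log_le_iff_le_exp hw).1 h1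
    refine h2.trans ?_
    rw [Real.exp_neg, ← one_div]
    apply one_div_le_one_div_of_le (by norm_num)
    have h3 := Real.exp_one_gt_d9
    have h4 : Real.exp 4 = Real.exp 1 ^ 4 := by rw [← Real.exp_nat_mul]; norm_num
    rw [h4]
    have h5 : (2.7:ℝ) ^ 4 ≤ Real.exp 1 ^ 4 := pow_le_pow_left₀ (by norm_num) (by linarith) 4
    norm_num at h5 ⊢; linarith
  have hε1' : ε ≤ 1 := by rw [← hw6]; exact pow_le_one₀ hw.le (by linarith)
  have hB : 1 ≤ Bf f R := by
    rw [Bf, Real.one_le_sqrt]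
    have : 0 ≤ ∑ n ∈ (Finset.Icc 2 ⌊R⌋₊).filter IsPrimePow, f n ^ 2 / (n : ℝ) :=
      Finset.sum_nonneg fun n _ => by positivity
    linarith
  have hTB : T ≤ T * Bf f R / ε := by
    rw [le_div_iff₀ hε0]
    exact mul_le_mul_of_nonneg_left (hε1'.trans hB) hT0.le
  have hlogT : Real.log T ≤ Real.log (T * Bf f R / ε) := Real.log_le_log hT0 hTB
  have hlog1 : 1 ≤ Real.log T := by
    rw [Real.le_log_iff_exp_le (by linarith)]
    have := Real.exp_one_lt_d9; linarith
  set G := Real.log (T * Bf f R / ε) with hG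
  have hwG : w ≤ w * G := by nlinarith
  by_cases htriv : 1 ≤ w * G
  · have : |Fx f x y - μ.real (Set.Iic y)| ≤ 1 := by rw [abs_le]; constructor <;> linarith
    linarith
  push Not at htriv
  -- size of log x
  have hL : 1 / w ^ 12 ≤ Real.log x := by
    have hsq : 0 < Real.sqrt (Real.log x) := Real.sqrt_pos.2 hlx0
    rw [div_lt_iff₀ hsq] at hε1
    rw [div_le_iff₀ (by positivity)]
    have h1 : Real.log x * w ^ 12 = (ε * Real.sqrt (Real.log x)) ^ 2 := by
      rw [mul_pow, Real.sq_sqrt hlx0.le, ← hw6]; ring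
    rw [h1]; nlinarith
  set s := x ^ ((1:ℝ)/48) with hsdef
  have hx0 : 0 < x := by linarith
  have hs0 : 0 < s := Real.rpow_pos_of_pos hx0 _
  have hsx : x = s ^ 48 := by
    rw [hsdef, ← Real.rpow_natCast, ← Real.rpow_mul hx0.le]; norm_num
  have hlxs : Real.log x = 48 * Real.log s := by conv_lhs => rw [hsx, Real.log_pow]
                                                 norm_num
  have hs : 1 / w ^ 11 ≤ s := by
    have h1 : Real.log s ≤ s := (Real.log_le_sub_one_of_pos hs0).trans (by linarith)
    have h2 : 1 / w ^ 11 = (w * 48) * (1 / w ^ 12) / 48 := by field_simp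
    rw [h2]
    have h3 : (w * 48) * (1 / w ^ 12) ≤ 1 * (1 / w ^ 12) := by
      gcongr; linarith
    linarith
  have hTs : T ≤ s ^ 2 := by
    have h1 : Real.log T ≤ Real.log (s ^ 2) := by
      rw [Real.log_pow]
      have h2 : w * Real.log T < 1 := lt_of_le_of_lt (by gcongr) htriv
      have h3 : Real.log T ≤ 1 / w := by rw [le_div_iff₀ hw]; linarith
      have h4 : 1 / w = w ^ 11 * (1 / w ^ 12) := by field_simp
      have h5 : w ^ 11 * (1 / w ^ 12) ≤ (1/24) * (1 / w ^ 12) := by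
        gcongr
        have : w ^ 11 ≤ (1/50) ^ 11 := pow_le_pow_left₀ hw.le hw50 11
        norm_num at this ⊢; linarith
      push_cast
      linarith
    exact (Real.log_le_log_iff hT0 (by positivity)).1 h1
  set z := x ^ ε with hzdef
  have hlz : Real.log z = w ^ 6 * Real.log x := by rw [hzdef, Real.log_rpow hx0, hw6]
  have hz0 : 0 < z := Real.rpow_pos_of_pos hx0 _
  have hlz6 : 1 / w ^ 6 ≤ Real.log z := by
    rw [hlz]
    have : 1 / w ^ 6 = w ^ 6 * (1 / w ^ 12) := by field_simp
    rw [this]; gcongr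
  have hz6 : 1 / w ^ 6 ≤ z := by
    have := Real.log_le_sub_one_of_pos hz0
    linarith
  have hlz2 : 2 ≤ Real.log z := by
    refine le_trans ?_ hlz6
    rw [le_div_iff₀ (by positivity)]
    have : w ^ 6 ≤ (1/50) ^ 6 := pow_le_pow_left₀ hw.le hw50 6
    norm_num at this ⊢; linarith
  have hz1 : 1 ≤ z := by
    have := Real.log_le_sub_one_of_pos hz0
    linarith
  have hz8 : z ≤ s ^ 8 := by
    have : s ^ 8 = x ^ ((1:ℝ)/6) := by
      rw [hsdef, ← Real.rpow_natCast, ← Real.rpow_mul hx0.le]; norm_num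
    rw [this]
    apply Real.rpow_le_rpow_of_exponent_le (by linarith)
    rw [← hw6]
    have : w ^ 6 ≤ (1/50) ^ 6 := pow_le_pow_left₀ hw.le hw50 6
    norm_num at this ⊢; linarith
  have hx1 : 1 ≤ x := by linarith
  have hN1 : 1 ≤ ⌊x⌋₊ := (Nat.one_le_floor_iff x).2 hx1
  have := ewU_prob _ hN1
  obtain ⟨d1, d2⟩ := ew_delta2 f hf η hE h x z s w T hw hw50 hs hsx hz6 hz8 hT hTs (hη.trans hw2'.ge)
  have hc := ew_combine f hf μ hμ (ewU ⌊x⌋₊) (⌊z⌋₊ + 1) (1 / T) (3 * w) w w Q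
    (by
      have := ew_null ⌊x⌋₊ (fun n => n = 0) (fun n hn _ => by omega)
      simpa using this)
    (by positivity) hQ0
    (ew_delta1 x z s w hw hw50 hs hsx hz1 hlz hlz2) d1 d2 hQ y
  have hxw : 1 / x ≤ w := by
    have h1 := Real.log_le_sub_one_of_pos hx0
    have h2 : 1 / w ≤ 1 / w ^ 12 := by
      apply one_div_le_one_div_of_le (by positivity)
      exact pow_le_of_le_one hw.le (by linarith) (by norm_num)
    rw [one_div_le hx0 hw]
    linarith
  have htri := abs_sub_le (Fx f x y) ((ewU ⌊x⌋₊).real {n | f n ≤ y}) (μ.real (Set.Iic y))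
  have := hF.1
  linarith

/-- **Effective Erdős–Wintner theorem, continuous case** (Theorem 1.2):
there is an absolute constant `C` such that, uniformly for all real additive `f`
satisfying (1.1) and (1.2), all `R ≥ 3`, `T ≥ 3`, `x ≥ 3` and `1/√(log x) < ε ≤ 1/2`
with `2log₂R + T²η_f(R)/2 + 7 ≤ (1/4)log(1/ε)` and `T²η_f(x^ε) ≤ ε^{1/3}`, one has
`‖F_x − F‖_∞ ≤ C (Q_F(1/T) + ε^{1/6} log(T B_f(R)/ε) + η_f(R))`, where `F` is the
limiting distribution with characteristic function
`φ_F(τ) = ∏_p (1 − 1/p) Σ_{ν≥0} e^{iτ f(p^ν)}/p^ν`. -/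
theorem effective_erdos_wintner_continuous :
    ∃ C : ℝ, 0 < C ∧
      ∀ (f : ℕ → ℝ) (η : ℝ → ℝ) (μ : Measure ℝ),
        IsAdditive f → EWConv f → DivergentCase f → EtaBound f η →
        IsProbabilityMeasure μ →
        -- the characteristic function of the limit law F is the Euler product (1.3)
        (∀ τ : ℝ, Tendsto (fun N : ℕ =>
            ∏ p ∈ (Finset.range N).filter Nat.Prime,
              ((1 - 1/(p:ℂ)) * ∑' ν : ℕ,
                Complex.exp ((τ * f (p ^ ν) : ℝ) * Complex.I) / (p : ℂ) ^ ν))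
          atTop (𝓝 (∫ y : ℝ, Complex.exp ((τ * y : ℝ) * Complex.I) ∂μ))) →
        ∀ R T x ε : ℝ, 3 ≤ R → 3 ≤ T → 3 ≤ x →
          1 / Real.sqrt (Real.log x) < ε → ε ≤ 1/2 →
          2 * Real.log (Real.log R) + T^2 * η R / 2 + 7 ≤ Real.log (1/ε) / 4 →
          T^2 * η (x ^ ε) ≤ ε ^ ((1:ℝ)/3) →
          ∀ y : ℝ,
            |Fx f x y - (μ (Set.Iic y)).toReal| ≤
              C * ((⨆ z : ℝ, ((μ (Set.Iic (z + 1/T))).toReal - (μ (Set.Iic z)).toReal))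
                + ε ^ ((1:ℝ)/6) * Real.log (T * Bf f R / ε) + η R) := by
  refine ⟨10, by norm_num, ?_⟩
  intro f η μ hf hE _ h hpr hμ R T x ε hR hT hx hε1 _ hH hη y
  exact ew_main f η μ hf hE h hpr hμ R T x ε hR hT hx hε1 hH hη y

end
end

section
/- Let f be a real additive function such that Σ_{p : f(p)≠0} 1/p < ∞. Then, uniformly for t ≥ 3 and positive integers m ≤ t, one has Σ_{p ≤ t} (1 − v_f(p; m))/p ≤ log₃t + O(1) and Σ_{p ≤ t} (1 − v_f(p; m))·(log p)/p ≤ β_f(t)·log t + O(log₂t), where the implied constants may depend on f. -/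
open Filter Topology Finset MeasureTheory
open scoped Classical

noncomputable section

/-- The sifted multiplicative function `v_f(·; m)` at a prime `p`:
`v_f(p; m) = v_f(p)` if `p ∤ m` and `0` if `p ∣ m`. -/
def vfm (f : ℕ → ℝ) (m p : ℕ) : ℝ := if p ∣ m then 0 else vf f p

lemma aux_uf_prime (f : ℕ → ℝ) (p : ℕ) (hp : p.Prime) : uf f p = if f p ≠ 0 then 1 else 0 := by
  unfold uf
  simp [hp.primeFactors, hp.factorization]

lemma aux_vf_prime (f : ℕ → ℝ) (p : ℕ) (hp : p.Prime) : 1 - vf f p = uf f p := by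
  rw [aux_uf_prime f p hp]
  unfold vf
  by_cases h : f p = 0 <;> simp [hp.primeFactors, hp.factorization, h]

lemma aux_pow_dvd (n p : ℕ) (hp : p.Prime) : p ^ (n / p) ∣ n.factorial := by
  have h1 := Nat.prod_factorial_dvd_factorial_sum (Finset.range (n / p)) (fun _ => p)
  simp only [Finset.prod_const, Finset.sum_const, Finset.card_range, smul_eq_mul] at h1
  exact ((pow_dvd_pow_of_dvd (Nat.dvd_factorial hp.pos le_rfl) _).trans h1).trans
    (Nat.factorial_dvd_factorial (Nat.div_mul_le_self n p))

lemma aux_mertens1 (n : ℕ) (hn : 1 ≤ n) :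
    ∑ p ∈ (Finset.range (n + 1)).filter Nat.Prime, Real.log p / (p : ℝ)
      ≤ Real.log n + Real.log 4 := by
  have hdvd : ∏ p ∈ (Finset.range (n + 1)).filter Nat.Prime, p ^ (n / p) ∣ n.factorial := by
    apply Finset.prod_dvd_of_isRelPrime
    · intro p hp q hq hpq
      have hp' : p.Prime := by simpa using (Finset.mem_filter.1 hp).2
      have hq' : q.Prime := by simpa using (Finset.mem_filter.1 hq).2
      have : Nat.Coprime (p ^ (n / p)) (q ^ (n / q)) :=
        Nat.Coprime.pow _ _ ((Nat.coprime_primes hp' hq').2 hpq)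
      exact Nat.coprime_iff_isRelPrime.1 this
    · intro p hp
      exact aux_pow_dvd n p (Finset.mem_filter.1 hp).2
  have hle := Nat.le_of_dvd (Nat.factorial_pos n) hdvd
  have hle2 := hle.trans (Nat.factorial_le_pow n)
  have hn0 : (0 : ℝ) < n := by exact_mod_cast hn
  have hlog : ∑ p ∈ (Finset.range (n + 1)).filter Nat.Prime, ((n / p : ℕ) : ℝ) * Real.log p
      ≤ n * Real.log n := by
    have h3 : ((∏ p ∈ (Finset.range (n + 1)).filter Nat.Prime, p ^ (n / p) : ℕ) : ℝ)
        ≤ (n : ℝ) ^ n := by exact_mod_cast hle2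
    have hpos : 0 < ∏ p ∈ (Finset.range (n + 1)).filter Nat.Prime, p ^ (n / p) :=
      Finset.prod_pos (fun p hp => pow_pos (Finset.mem_filter.1 hp).2.pos _)
    have h4 := Real.log_le_log (by exact_mod_cast hpos) h3
    rw [Real.log_pow] at h4
    push_cast at h4
    rw [Real.log_prod (fun p hp => by
      have := (Finset.mem_filter.1 hp).2.pos
      positivity)] at h4
    simpa [Real.log_pow] using h4
  have htheta : ∑ p ∈ (Finset.range (n + 1)).filter Nat.Prime, Real.log p ≤ Real.log 4 * n := by
    have h := primorial_le_four_pow n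
    have h3 : ((∏ p ∈ (Finset.range (n + 1)).filter Nat.Prime, p : ℕ) : ℝ) ≤ (4 : ℝ) ^ n := by
      unfold primorial at h
      exact_mod_cast h
    have hpos : 0 < ∏ p ∈ (Finset.range (n + 1)).filter Nat.Prime, p :=
      Finset.prod_pos (fun p hp => (Finset.mem_filter.1 hp).2.pos)
    have h4 := Real.log_le_log (by exact_mod_cast hpos) h3
    rw [Real.log_pow] at h4
    push_cast at h4
    rw [Real.log_prod (fun p hp => by
      have := (Finset.mem_filter.1 hp).2.pos
      positivity)] at h4
    linarith
  have key : (n : ℝ) * ∑ p ∈ (Finset.range (n + 1)).filter Nat.Prime, Real.log p / (p : ℝ)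
      ≤ ∑ p ∈ (Finset.range (n + 1)).filter Nat.Prime, ((n / p : ℕ) : ℝ) * Real.log p
        + ∑ p ∈ (Finset.range (n + 1)).filter Nat.Prime, Real.log p := by
    rw [Finset.mul_sum, ← Finset.sum_add_distrib]
    apply Finset.sum_le_sum
    intro p hp
    have hp' := (Finset.mem_filter.1 hp).2
    have h1 : (n : ℝ) / p ≤ ((n / p : ℕ) : ℝ) + 1 := by
      rw [← Nat.floor_div_eq_div (K := ℝ)]
      exact (Nat.lt_floor_add_one _).le
    have h2 : 0 ≤ Real.log p := Real.log_natCast_nonneg p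
    calc (n : ℝ) * (Real.log p / p) = (n / p) * Real.log p := by ring
      _ ≤ (((n / p : ℕ) : ℝ) + 1) * Real.log p := by gcongr
      _ = _ := by ring
  have : (n : ℝ) * ∑ p ∈ (Finset.range (n + 1)).filter Nat.Prime, Real.log p / (p : ℝ)
      ≤ n * (Real.log n + Real.log 4) := by linarith
  exact le_of_mul_le_mul_left this hn0

lemma aux_mertens2 : ∃ D : ℝ, ∀ n : ℕ, 2 ≤ n →
    ∑ p ∈ (Finset.range (n + 1)).filter Nat.Prime, 1 / (p : ℝ)
      ≤ Real.log (Real.log n) + D := by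
  have hl2 : 0 < Real.log 2 := Real.log_pos (by norm_num)
  set D : ℝ := 1 / 2 - (Real.log 2 / 2 - Real.log 2 - Real.log 4) / Real.log 2
    - Real.log (Real.log 2) with hD
  refine ⟨D, fun n hn => ?_⟩
  have main : ∑ p ∈ (Finset.range (n + 1)).filter Nat.Prime, 1 / (p : ℝ)
      ≤ (∑ p ∈ (Finset.range (n + 1)).filter Nat.Prime, Real.log p / (p : ℝ)
          - Real.log n - Real.log 4) / Real.log n + Real.log (Real.log n) + D := by
    induction n, hn using Nat.le_induction with
    | base =>
      have : (Finset.range (2 + 1)).filter Nat.Prime = {2} := by decide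
      rw [this]
      simp [hD]
    | succ n hn ih =>
      have hA := aux_mertens1 n (by omega)
      rw [Finset.range_add_one (n := n + 1), Finset.filter_insert]
      set A := ∑ p ∈ (Finset.range (n + 1)).filter Nat.Prime, Real.log p / (p : ℝ)
      set S := ∑ p ∈ (Finset.range (n + 1)).filter Nat.Prime, 1 / (p : ℝ)
      have hn0 : (2 : ℝ) ≤ n := by exact_mod_cast hn
      have hx : 0 < Real.log n := Real.log_pos (by linarith)
      have hxy : Real.log n ≤ Real.log ((n + 1 : ℕ) : ℝ) :=
        Real.log_le_log (by linarith) (by push_cast; linarith)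
      have hy : 0 < Real.log ((n + 1 : ℕ) : ℝ) := by linarith
      set x := Real.log n
      set y := Real.log ((n + 1 : ℕ) : ℝ) with hydef
      have h1 : (A - x - Real.log 4) / x ≤ (A - x - Real.log 4) / y := by
        rw [div_le_div_iff₀ hx hy]
        nlinarith
      have h2 : (y - x) / y ≤ Real.log y - Real.log x := by
        have := Real.log_le_sub_one_of_pos (div_pos hx hy)
        rw [Real.log_div hx.ne' hy.ne'] at this
        have e : (y - x) / y = 1 - x / y := by field_simp
        linarith
      have h3 : (A - x - Real.log 4) / y = (A - y - Real.log 4) / y + (y - x) / y := by ring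
      split_ifs with hp
      · rw [Finset.sum_insert (by simp), Finset.sum_insert (by simp), ← hydef]
        have h4 : (y / ((n + 1 : ℕ) : ℝ) + A - y - Real.log 4) / y
            = 1 / ((n + 1 : ℕ) : ℝ) + (A - y - Real.log 4) / y := by
          field_simp
          ring
        change _ + S ≤ (_ + A - y - Real.log 4) / y + _ + _
        rw [h4]
        linarith
      · change S ≤ (A - y - Real.log 4) / y + _ + _
        linarith
  have hA := aux_mertens1 n (by omega)
  have hx : 0 < Real.log n := Real.log_pos (by exact_mod_cast hn)
  have := div_nonpos_of_nonpos_of_nonneg (sub_nonpos.2 (by linarith [hA]) :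
    (∑ p ∈ (Finset.range (n + 1)).filter Nat.Prime, Real.log p / (p : ℝ)
          - Real.log n) - Real.log 4 ≤ 0) hx.le
  linarith

lemma aux_omega (m : ℕ) (hm : 1 ≤ m) : (m.primeFactors.card : ℝ) * Real.log 2 ≤ Real.log m := by
  have h1 : 2 ^ m.primeFactors.card ≤ m := by
    calc 2 ^ m.primeFactors.card ≤ ∏ p ∈ m.primeFactors, p :=
          Finset.pow_card_le_prod _ _ _ (fun p hp => (Nat.prime_of_mem_primeFactors hp).two_le)
      _ ≤ m := Nat.le_of_dvd hm (Nat.prod_primeFactors_dvd m)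
  have h2 : (2 : ℝ) ^ m.primeFactors.card ≤ m := by exact_mod_cast h1
  have := Real.log_le_log (by positivity) h2
  rwa [Real.log_pow] at this

/-- splitting the primes dividing m at y -/
lemma aux_split (g : ℝ → ℝ) (y : ℝ) (m : ℕ) (hy : 0 < y) (hg0 : ∀ p : ℕ, 0 ≤ g p)
    (hg : ∀ x, y ≤ x → g x ≤ g y) :
    ∑ p ∈ m.primeFactors, g p ≤ ∑ p ∈ (Finset.range (⌊y⌋₊ + 1)).filter Nat.Prime, g p
      + m.primeFactors.card * g y := by
  rw [← Finset.sum_filter_add_sum_filter_not m.primeFactors (fun p : ℕ => (p : ℝ) ≤ y)]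
  have hgy : 0 ≤ g y := (hg0 ⌈y⌉₊).trans (hg _ (Nat.le_ceil y))
  refine add_le_add ?_ ?_
  · apply Finset.sum_le_sum_of_subset_of_nonneg
    · intro p hp
      simp only [Finset.mem_filter, Finset.mem_range] at hp ⊢
      exact ⟨Nat.lt_succ_of_le (Nat.le_floor hp.2), Nat.prime_of_mem_primeFactors hp.1⟩
    · intro p _ _
      exact hg0 p
  · calc _ ≤ ∑ p ∈ m.primeFactors.filter (fun p : ℕ => ¬ (p : ℝ) ≤ y), g y := by
          apply Finset.sum_le_sum
          intro p hp
          exact hg _ (not_le.1 (Finset.mem_filter.1 hp).2).le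
      _ = ((m.primeFactors.filter (fun p : ℕ => ¬ (p : ℝ) ≤ y)).card : ℝ) * g y := by simp
      _ ≤ _ := by
          gcongr
          exact Finset.filter_subset _ _

lemma aux_dom (f : ℕ → ℝ) (g : ℝ → ℝ) (hg0 : ∀ p : ℕ, 0 ≤ g p) (P : Finset ℕ)
    (hP : ∀ p ∈ P, p.Prime) (m : ℕ) (hm : 1 ≤ m) :
    ∑ p ∈ P, (1 - vfm f m p) * g p ≤ ∑ p ∈ P, uf f p * g p + ∑ p ∈ m.primeFactors, g p := by
  have h : ∑ p ∈ P, (1 - vfm f m p) * g p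
      ≤ ∑ p ∈ P, (uf f p * g p + if p ∣ m then g p else 0) := by
    apply Finset.sum_le_sum
    intro p hp
    unfold vfm
    have h1 := aux_vf_prime f p (hP p hp)
    have h2 := aux_uf_prime f p (hP p hp)
    have h3 : 0 ≤ uf f p := by rw [h2]; split_ifs <;> norm_num
    have h4 := mul_nonneg h3 (hg0 p)
    split_ifs
    · linarith
    · rw [h1]; linarith
  rw [Finset.sum_add_distrib, ← Finset.sum_filter] at h
  refine h.trans (add_le_add le_rfl ?_)
  apply Finset.sum_le_sum_of_subset_of_nonneg
  · intro p hp
    have := Finset.mem_filter.1 hp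
    exact Nat.mem_primeFactors.2 ⟨hP p this.1, this.2, by omega⟩
  · intro p _ _
    exact hg0 p

lemma aux_uf_summable (f : ℕ → ℝ)
    (hfin : Summable (fun p : Nat.Primes => if f (p : ℕ) ≠ 0 then (1 : ℝ) / ((p : ℕ) : ℝ) else 0)) :
    Summable (fun p : Nat.Primes => uf f (p : ℕ) / ((p : ℕ) : ℝ)) := by
  refine hfin.congr (fun p => ?_)
  rw [aux_uf_prime f p p.2]
  split_ifs <;> simp

lemma aux_uf_nonneg (f : ℕ → ℝ) (n : ℕ) : 0 ≤ uf f n := by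
  unfold uf
  split_ifs <;> norm_num

lemma aux_term_summable (f : ℕ → ℝ)
    (hs : Summable (fun p : Nat.Primes => uf f (p : ℕ) / ((p : ℕ) : ℝ))) (y : ℝ) :
    Summable (fun p : Nat.Primes =>
      if y < ((p : ℕ) : ℝ) then uf f (p : ℕ) / ((p : ℕ) : ℝ) else 0) := by
  have h0 : ∀ p : ℕ, 0 ≤ uf f p / (p : ℝ) := fun p => div_nonneg (aux_uf_nonneg f p) (by positivity)
  refine Summable.of_nonneg_of_le (fun p => ?_) (fun p => ?_) hs
  · split_ifs
    · exact h0 p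
    · exact le_rfl
  · split_ifs
    · exact le_rfl
    · exact h0 p

lemma aux_finset_le (h : Nat.Primes → ℝ) (k : ℕ → ℝ) (hk : ∀ p : Nat.Primes, h p = k p)
    (hs : Summable h) (h0 : ∀ p, 0 ≤ h p) (P : Finset ℕ) (hP : ∀ p ∈ P, p.Prime) :
    ∑ p ∈ P, k p ≤ ∑' p, h p := by
  obtain ⟨Q, hQ⟩ : ∃ Q : Finset Nat.Primes, ∑ p ∈ P, k p = ∑ p ∈ Q, h p := by
    refine ⟨P.subtype Nat.Prime, ?_⟩
    rw [← Finset.sum_subtype_of_mem k hP]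
    exact Finset.sum_congr rfl (fun p _ => (hk p).symm)
  rw [hQ]
  exact hs.sum_le_tsum Q (fun p _ => h0 p)

lemma aux_alpha_antitone (f : ℕ → ℝ)
    (hs : Summable (fun p : Nat.Primes => uf f (p : ℕ) / ((p : ℕ) : ℝ))) :
    Antitone (alphaf f) := by
  intro a b hab
  unfold alphaf
  refine Summable.tsum_le_tsum (fun p => ?_) (aux_term_summable f hs b) (aux_term_summable f hs a)
  have h0 : 0 ≤ uf f p / ((p : ℕ) : ℝ) := div_nonneg (aux_uf_nonneg f p) (by positivity)
  split_ifs with h1 h2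
  · exact le_rfl
  · exact absurd (lt_of_le_of_lt hab h1) h2
  · exact h0
  · exact le_rfl

lemma aux_ind (c : ℝ) (t : ℝ) (hc1 : 1 ≤ c) (hct : c ≤ t) :
    IntervalIntegrable (fun s : ℝ => (if s < c then (1 : ℝ) else 0) / s) volume 1 t ∧
    ∫ s in (1:ℝ)..t, (if s < c then (1 : ℝ) else 0) / s = Real.log c := by
  have i1 : IntervalIntegrable (fun s : ℝ => 1 / s) volume 1 c := by
    apply intervalIntegral.intervalIntegrable_one_div
    · intro x hx
      rw [Set.uIcc_of_le hc1] at hx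
      linarith [hx.1]
    · exact continuousOn_id
  have ae1 : ∀ᵐ s : ℝ, s ∈ Set.uIoc 1 c →
      (fun s : ℝ => 1 / s) s = (if s < c then (1 : ℝ) else 0) / s := by
    have : ∀ᵐ s : ℝ, s ≠ c := by simp [ae_iff]
    filter_upwards [this] with s hs hmem
    rw [Set.uIoc_of_le hc1] at hmem
    simp [lt_of_le_of_ne hmem.2 hs]
  have eq2 : ∀ s ∈ Set.uIoc c t, (fun _ : ℝ => (0:ℝ)) s = (if s < c then (1 : ℝ) else 0) / s := by
    intro s hs
    rw [Set.uIoc_of_le hct] at hs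
    simp [not_lt.2 hs.1.le]
  have j1 : IntervalIntegrable (fun s : ℝ => (if s < c then (1 : ℝ) else 0) / s) volume 1 c :=
    i1.congr_ae ((ae_restrict_iff' measurableSet_uIoc).2 ae1)
  have j2 : IntervalIntegrable (fun s : ℝ => (if s < c then (1 : ℝ) else 0) / s) volume c t :=
    (intervalIntegrable_const (c := (0:ℝ))).congr eq2
  refine ⟨j1.trans j2, ?_⟩
  rw [← intervalIntegral.integral_add_adjacent_intervals j1 j2,
    ← intervalIntegral.integral_congr_ae ae1,
    ← intervalIntegral.integral_congr_ae (Filter.Eventually.of_forall eq2)]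
  rw [integral_one_div_of_pos one_pos (by linarith)]
  simp

lemma aux_beta (f : ℕ → ℝ)
    (hs : Summable (fun p : Nat.Primes => uf f (p : ℕ) / ((p : ℕ) : ℝ))) (t : ℝ) (ht : 3 ≤ t) :
    ∑ p ∈ (Finset.range (⌊t⌋₊ + 1)).filter Nat.Prime, uf f p * (Real.log p / (p : ℝ))
      ≤ betaf f t * Real.log t := by
  have hlog : 0 < Real.log t := Real.log_pos (by linarith)
  have e : betaf f t * Real.log t = ∫ s in (1:ℝ)..t, alphaf f s / s := by
    unfold betaf
    field_simp
  rw [e]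
  set P := (Finset.range (⌊t⌋₊ + 1)).filter Nat.Prime
  have hPt : ∀ p ∈ P, 1 ≤ (p : ℝ) ∧ (p : ℝ) ≤ t := by
    intro p hp
    have h := Finset.mem_filter.1 hp
    refine ⟨by exact_mod_cast h.2.one_le, ?_⟩
    exact (Nat.le_floor_iff (by linarith)).1 (Nat.lt_succ_iff.1 (Finset.mem_range.1 h.1))
  have hPi : ∀ p ∈ P, IntervalIntegrable
      (fun s : ℝ => (uf f p / p) * ((if s < (p:ℝ) then (1 : ℝ) else 0) / s)) volume 1 t := by
    intro p hp
    exact (aux_ind p t (hPt p hp).1 (hPt p hp).2).1.const_mul _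
  have e2 : ∑ p ∈ P, uf f p * (Real.log p / (p : ℝ))
      = ∫ s in (1:ℝ)..t, ∑ p ∈ P, (uf f p / p) * ((if s < (p:ℝ) then (1 : ℝ) else 0) / s) := by
    rw [intervalIntegral.integral_finsetSum hPi]
    apply Finset.sum_congr rfl
    intro p hp
    rw [intervalIntegral.integral_const_mul, (aux_ind p t (hPt p hp).1 (hPt p hp).2).2]
    ring
  rw [e2]
  apply intervalIntegral.integral_mono_on (by linarith)
  · have := IntervalIntegrable.sum P hPi
    simpa only [Finset.sum_fn] using this
  · have h1 : IntervalIntegrable (alphaf f) volume 1 t :=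
      (aux_alpha_antitone f hs).intervalIntegrable
    have h2 : ContinuousOn (fun s : ℝ => s⁻¹) (Set.uIcc 1 t) := by
      apply ContinuousOn.inv₀ continuousOn_id
      intro x hx
      rw [Set.uIcc_of_le (by linarith)] at hx
      have := hx.1
      simp only [id]
      linarith
    simpa [div_eq_mul_inv] using h1.mul_continuousOn h2
  · intro s hs1
    have hle : ∑ p ∈ P, (if s < (p:ℝ) then uf f p / p else 0) ≤ alphaf f s := by
      unfold alphaf
      refine aux_finset_le _ (fun p : ℕ => if s < (p:ℝ) then uf f p / p else 0) (fun p => rfl)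
        (aux_term_summable f hs s) (fun p => ?_) P (fun p hp => (Finset.mem_filter.1 hp).2)
      split_ifs
      · exact div_nonneg (aux_uf_nonneg f p) (by positivity)
      · exact le_rfl
    have hs0 : 0 ≤ s := by linarith [hs1.1]
    calc _ = (∑ p ∈ P, (if s < (p:ℝ) then uf f p / p else 0)) / s := by
          rw [Finset.sum_div]
          apply Finset.sum_congr rfl
          intro p _
          split_ifs <;> simp [div_eq_mul_inv]
      _ ≤ _ := by gcongr

/-- The two elementary estimates of Section 3: uniformly for `t ≥ 3` and `1 ≤ m ≤ t`,
`Σ_{p ≤ t} (1 − v_f(p;m))/p ≤ log₃ t + O(1)` and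
`Σ_{p ≤ t} (1 − v_f(p;m)) log p / p ≤ β_f(t) log t + O(log₂ t)`. -/
theorem sifted_prime_sums (f : ℕ → ℝ) (hadd : IsAdditive f)
    (hfin : Summable (fun p : Nat.Primes => if f (p : ℕ) ≠ 0 then (1 : ℝ) / ((p : ℕ) : ℝ) else 0)) :
    ∃ C : ℝ, 0 < C ∧ ∀ (t : ℝ) (m : ℕ), 3 ≤ t → 1 ≤ m → (m : ℝ) ≤ t →
      (∑ p ∈ (Finset.range (⌊t⌋₊ + 1)).filter Nat.Prime,
          (1 - vfm f m p) / (p : ℝ)) ≤ Real.log (Real.log (Real.log t)) + C ∧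
      (∑ p ∈ (Finset.range (⌊t⌋₊ + 1)).filter Nat.Prime,
          (1 - vfm f m p) * Real.log p / (p : ℝ)) ≤
        betaf f t * Real.log t + C * Real.log (Real.log t) := by
  have hs := aux_uf_summable f hfin
  obtain ⟨D, hD⟩ := aux_mertens2
  set S := ∑' p : Nat.Primes, uf f (p : ℕ) / ((p : ℕ) : ℝ) with hS
  have hexp : Real.exp 1 < 3 := by linarith [Real.exp_one_lt_d9]
  have hexp2 : 2 < Real.exp 1 := by linarith [Real.exp_one_gt_d9]
  have hl3 : 1 < Real.log 3 := (Real.lt_log_iff_exp_lt (by norm_num)).2 hexp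
  set c := Real.log (Real.log 3) with hc
  have hc0 : 0 < c := Real.log_pos hl3
  have hl2 : 0 < Real.log 2 := Real.log_pos (by norm_num)
  have hl4 : 0 < Real.log 4 := Real.log_pos (by norm_num)
  set C1 := S + Real.log (1 + 1 / c) + D + 1 / Real.log 2 with hC1
  set C2 := (1 + Real.log 4 + 1 / Real.log 2) * (1 + 1 / c) with hC2
  refine ⟨max C1 C2, lt_of_lt_of_le (by positivity) (le_max_right _ _), ?_⟩
  intro t m ht hm hmt
  have hlt : Real.log 3 ≤ Real.log t := Real.log_le_log (by norm_num) ht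
  have hlt0 : 1 < Real.log t := by linarith
  set L := Real.log (Real.log t) with hL
  have hcL : c ≤ L := Real.log_le_log (by linarith) hlt
  have hL0 : 0 < L := by linarith
  set y := Real.exp 1 * Real.log t with hy
  have hey : Real.exp 1 ≤ y := by
    rw [hy]; nlinarith
  have hy0 : 0 < y := by linarith
  have hlogy : Real.log y = 1 + L := by
    rw [hy, Real.log_mul (by positivity) (by linarith), Real.log_exp]
  have hfl : 2 ≤ ⌊y⌋₊ := Nat.le_floor (by push_cast; linarith)
  have hfl' : (2 : ℝ) ≤ (⌊y⌋₊ : ℝ) := by exact_mod_cast hfl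
  have hfly : Real.log (⌊y⌋₊ : ℝ) ≤ 1 + L := by
    rw [← hlogy]
    exact Real.log_le_log (by linarith) (Nat.floor_le hy0.le)
  have h1L : 1 + L ≤ (1 + 1 / c) * L := by
    have : 1 ≤ L / c := by rwa [one_le_div hc0]
    calc 1 + L ≤ L / c + L := by linarith
      _ = _ := by ring
  have hom : (m.primeFactors.card : ℝ) ≤ Real.log t / Real.log 2 := by
    rw [le_div_iff₀ hl2]
    exact (aux_omega m hm).trans (Real.log_le_log (by exact_mod_cast hm) hmt)
  have hP : ∀ p ∈ (Finset.range (⌊t⌋₊ + 1)).filter Nat.Prime, p.Prime :=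
    fun p hp => (Finset.mem_filter.1 hp).2
  constructor
  · have a1 := aux_dom f (fun x => 1 / x) (fun p => by positivity) _ hP m hm
    have a2 := aux_split (fun x => 1 / x) y m hy0 (fun p => by positivity)
      (fun x hx => one_div_le_one_div_of_le hy0 hx)
    have a3 := hD _ hfl
    have a4 : ∑ p ∈ (Finset.range (⌊t⌋₊ + 1)).filter Nat.Prime, uf f p * (1 / (p : ℝ)) ≤ S := by
      refine aux_finset_le _ (fun p : ℕ => uf f p * (1 / (p : ℝ))) (fun p => by ring) hs
        (fun p => div_nonneg (aux_uf_nonneg f p) (by positivity)) _ hP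
    have a5 : (m.primeFactors.card : ℝ) * (1 / y) ≤ 1 / Real.log 2 := by
      calc (m.primeFactors.card : ℝ) * (1 / y) ≤ (Real.log t / Real.log 2) * (1 / Real.log t) := by
            gcongr
            rw [hy]; nlinarith
        _ = _ := by field_simp
    have a6 : Real.log (Real.log (⌊y⌋₊ : ℝ)) ≤ Real.log L + Real.log (1 + 1 / c) := by
      calc Real.log (Real.log (⌊y⌋₊ : ℝ)) ≤ Real.log ((1 + 1 / c) * L) :=
            Real.log_le_log (Real.log_pos (by linarith)) (by linarith)
        _ = _ := by rw [Real.log_mul (by positivity) hL0.ne']; ring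
    have a7 : ∑ p ∈ (Finset.range (⌊t⌋₊ + 1)).filter Nat.Prime, (1 - vfm f m p) / (p : ℝ)
        = ∑ p ∈ (Finset.range (⌊t⌋₊ + 1)).filter Nat.Prime, (1 - vfm f m p) * (1 / (p : ℝ)) :=
      Finset.sum_congr rfl (fun p _ => by ring)
    rw [a7]
    have := le_max_left C1 C2
    linarith
  · have g0 : ∀ p : ℕ, 0 ≤ Real.log p / (p : ℝ) :=
      fun p => div_nonneg (Real.log_natCast_nonneg p) (by positivity)
    have a1 := aux_dom f (fun x => Real.log x / x) g0 _ hP m hm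
    have a2 := aux_split (fun x => Real.log x / x) y m hy0 g0
      (fun x hx => Real.log_div_self_antitoneOn hey (hey.trans hx) hx)
    have a3 := aux_mertens1 _ (show 1 ≤ ⌊y⌋₊ by omega)
    have a4 := aux_beta f hs t ht
    have a5 : (m.primeFactors.card : ℝ) * (Real.log y / y) ≤ (1 + L) * (1 / Real.log 2) := by
      calc (m.primeFactors.card : ℝ) * (Real.log y / y)
          ≤ (Real.log t / Real.log 2) * ((1 + L) / Real.log t) := by
            rw [hlogy]
            gcongr
            rw [hy]; nlinarith
        _ = _ := by field_simp
    have a7 : ∑ p ∈ (Finset.range (⌊t⌋₊ + 1)).filter Nat.Prime,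
          (1 - vfm f m p) * Real.log p / (p : ℝ)
        = ∑ p ∈ (Finset.range (⌊t⌋₊ + 1)).filter Nat.Prime,
          (1 - vfm f m p) * (Real.log p / (p : ℝ)) :=
      Finset.sum_congr rfl (fun p _ => by ring)
    rw [a7]
    have b1 : C2 * L ≤ max C1 C2 * L := by
      gcongr
      exact le_max_right _ _
    have b2 : (1 + Real.log 4 + 1 / Real.log 2) * (1 + L) ≤ C2 * L := by
      rw [hC2, mul_assoc]
      gcongr
    have b3 : 0 ≤ Real.log 4 * L := by positivity
    nlinarith

end
end
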